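/- arXiv:1510.05393 — 8 statements merged into one kernel-verified Lean document; each statement's English description precedes it below -/
import Mathlib

section
/- Let X be a proper metric space admitting a conical geodesic bicombing σ and whose isometry group acts cocompactly. Suppose there are a norm ‖·‖ on ℝ^n, sequences R_k → ∞ and ε_k → 0 of positive reals, and maps Φ_k : B(R_k) → X (where B(R) = {z ∈ ℝ^n : ‖z‖ ≤ R}) such that |d(Φ_k(x),Φ_k(y)) − ‖x−y‖| ≤ R_k·ε_k for all x,y ∈ B(R_k) and all k. Then there exists an isometric embedding of (ℝ^n,‖·‖) into X. -/
/-- A conical geodesic bicombing on a metric space `X`. -/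
def IsConicalBicombing {X : Type*} [MetricSpace X] (σ : X → X → ℝ → X) : Prop :=
  (∀ x y : X, σ x y 0 = x) ∧
  (∀ x y : X, σ x y 1 = y) ∧
  (∀ x y : X, ∀ t ∈ Set.Icc (0:ℝ) 1, ∀ t' ∈ Set.Icc (0:ℝ) 1,
      dist (σ x y t) (σ x y t') = |t - t'| * dist x y) ∧
  (∀ x y x' y' : X, ∀ t ∈ Set.Icc (0:ℝ) 1,
      dist (σ x y t) (σ x' y' t) ≤ (1 - t) * dist x x' + t * dist y y')

/-- The isometry group of `X` acts cocompactly. -/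
def CocompactIsometryGroup (X : Type*) [MetricSpace X] : Prop :=
  ∃ D : ℝ, 0 ≤ D ∧ ∀ x y : X, ∃ γ : X ≃ᵢ X, dist (γ x) y ≤ D

/-- `ν` is a norm on `ℝ^n`. -/
def IsNorm {n : ℕ} (ν : (Fin n → ℝ) → ℝ) : Prop :=
  (∀ x, ν x = 0 ↔ x = 0) ∧
  (∀ x y, ν (x + y) ≤ ν x + ν y) ∧
  (∀ (c : ℝ) x, ν (c • x) = |c| * ν x)

/-- A midpoint-type map: idempotent and `1/2`-contractive in each variable. -/
def IsConicalMidpoint {X : Type*} [MetricSpace X] (M : X → X → X) : Prop :=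
  (∀ x, M x x = x) ∧
  ∀ x y x' y', dist (M x y) (M x' y') ≤ (dist x x' + dist y y') / 2

namespace IsConicalMidpoint

section Iteration

variable {X : Type*}

/-- The symmetrising iteration `(x, y) ↦ (M x y, M y x)`. -/
def iter (M : X → X → X) (x y : X) : ℕ → X × X
  | 0 => (x, y)
  | k + 1 => (M (iter M x y k).1 (iter M x y k).2, M (iter M x y k).2 (iter M x y k).1)

lemma iter_swap (M : X → X → X) (x y : X) (k : ℕ) : iter M y x k = (iter M x y k).swap := by
  induction k with
  | zero => rfl
  | succ k ih => simp [iter, ih]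

end Iteration

variable {X : Type*} [MetricSpace X] {M : X → X → X}

lemma dist_right_le (hM : IsConicalMidpoint M) (a b z : X) :
    dist (M a b) z ≤ (dist a z + dist b z) / 2 := by
  simpa [hM.1 z] using hM.2 a b z z

lemma dist_iter_le (hM : IsConicalMidpoint M) (x y z : X) (B : ℝ) (K : ℕ)
    (h1 : dist (iter M x y K).1 z ≤ B) (h2 : dist (iter M x y K).2 z ≤ B) (k : ℕ) :
    dist (iter M x y (K + k)).1 z ≤ B ∧ dist (iter M x y (K + k)).2 z ≤ B := by
  induction k with
  | zero => exact ⟨h1, h2⟩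
  | succ k ih =>
    rw [← add_assoc]
    simp only [iter]
    constructor
    · linarith [hM.dist_right_le (iter M x y (K + k)).1 (iter M x y (K + k)).2 z, ih.1, ih.2]
    · linarith [hM.dist_right_le (iter M x y (K + k)).2 (iter M x y (K + k)).1 z, ih.1, ih.2]

lemma antitone_iter (hM : IsConicalMidpoint M) (x y : X) :
    Antitone fun k => dist (iter M x y k).1 (iter M x y k).2 := by
  refine antitone_nat_of_succ_le fun k => ?_
  have := hM.2 (iter M x y k).1 (iter M x y k).2 (iter M x y k).2 (iter M x y k).1
  rw [dist_comm (iter M x y k).2 (iter M x y k).1] at this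
  simp only [iter]
  linarith

lemma dist_iter_snd_add_le (hM : IsConicalMidpoint M) (x y : X) (i m : ℕ) :
    dist (iter M x y i).2 (iter M x y (i + m)).2 ≤
      m / 2 * dist (iter M x y i).1 (iter M x y i).2 := by
  induction m with
  | zero => simp
  | succ m ih =>
    have h1 := dist_triangle (iter M x y i).2 (iter M x y (i + m)).2 (iter M x y (i + (m + 1))).2
    have h2 : dist (iter M x y (i + m)).2 (iter M x y (i + (m + 1))).2 ≤
        dist (iter M x y i).1 (iter M x y i).2 / 2 := by
      have h3 := hM.dist_right_le (iter M x y (i + m)).2 (iter M x y (i + m)).1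
        (iter M x y (i + m)).2
      have h4 := hM.antitone_iter x y (Nat.le_add_right i m)
      rw [dist_self] at h3
      rw [← add_assoc, dist_comm]
      simp only [iter] at h4 ⊢
      linarith
    push_cast
    linarith

/-- The two components of the symmetrising iteration approach each other. This is the asymptotic
regularity of averaged nonexpansive maps, applied to the swap. -/
lemma tendsto_dist_iter (hM : IsConicalMidpoint M) (x y : X) :
    Filter.Tendsto (fun k => dist (iter M x y k).1 (iter M x y k).2) Filter.atTop (nhds 0) := by
  set d := ⨅ k, dist (iter M x y k).1 (iter M x y k).2 with hd
  have hbdd : BddBelow (Set.range fun k => dist (iter M x y k).1 (iter M x y k).2) :=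
    ⟨0, by rintro _ ⟨k, rfl⟩; exact dist_nonneg⟩
  have hlim : Filter.Tendsto (fun k => dist (iter M x y k).1 (iter M x y k).2) Filter.atTop
      (nhds d) := tendsto_atTop_ciInf (hM.antitone_iter x y) hbdd
  have hle : ∀ k, d ≤ dist (iter M x y k).1 (iter M x y k).2 := fun k => ciInf_le hbdd k
  have hd0 : 0 ≤ d := le_ciInf fun k => dist_nonneg
  have growth : ∀ m : ℕ, ∀ η > 0, ∀ᶠ i in Filter.atTop,
      (1 + m / 2) * d - η ≤ dist (iter M x y i).1 (iter M x y (i + m)).2 := by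
    intro m
    induction m with
    | zero =>
      intro η hη
      refine Filter.Eventually.of_forall fun i => ?_
      have := hle i
      simp only [Nat.cast_zero, add_zero]
      linarith
    | succ m ih =>
      intro η hη
      have hm : (0:ℝ) < m + 1 := by positivity
      have e1 := (Filter.tendsto_add_atTop_nat 1).eventually (ih (η / 4) (by positivity))
      have e2 := hlim.eventually_lt_const (show d < d + η / (m + 1) by
        have : 0 < η / (m + 1) := by positivity
        linarith)
      filter_upwards [e1, e2] with i h1 h2
      have h3 := hM.dist_right_le (iter M x y i).1 (iter M x y i).2 (iter M x y (i + (m + 1))).2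
      have h4 := hM.dist_iter_snd_add_le x y i (m + 1)
      have h5 : i + 1 + m = i + (m + 1) := by ring
      rw [h5] at h1
      have h6 : (iter M x y (i + 1)).1 = M (iter M x y i).1 (iter M x y i).2 := rfl
      rw [h6] at h1
      push_cast at h4 ⊢
      have h7 : ((m:ℝ) + 1) / 2 * dist (iter M x y i).1 (iter M x y i).2 ≤
          (m + 1) / 2 * d + η / 2 := by
        calc ((m:ℝ) + 1) / 2 * dist (iter M x y i).1 (iter M x y i).2
            ≤ (m + 1) / 2 * (d + η / (m + 1)) := by gcongr
          _ = (m + 1) / 2 * d + η / 2 := by field_simp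
      linarith
  have hzero : d = 0 := by
    by_contra hne
    have hpos : 0 < d := lt_of_le_of_ne hd0 (Ne.symm hne)
    obtain ⟨m, hm⟩ := exists_nat_gt ((2 * dist x y + 1) / d * 2)
    obtain ⟨i, hi⟩ := (growth m 1 one_pos).exists
    have hb := fun k => hM.dist_iter_le x y x (dist x y) 0 (by simp [iter])
      (by simp [iter, dist_comm]) k
    simp only [zero_add] at hb
    have h1 := dist_triangle_right (iter M x y i).1 (iter M x y (i + m)).2 x
    have h2 : (2 * dist x y + 1) < m / 2 * d := by
      rw [← div_lt_iff₀ hpos]; linarith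
    linarith [(hb i).1, (hb (i + m)).2]
  rwa [hzero] at hlim

lemma exists_tendsto_iter [CompleteSpace X] (hM : IsConicalMidpoint M) (x y : X) :
    ∃ c, Filter.Tendsto (fun k => (iter M x y k).1) Filter.atTop (nhds c) := by
  refine cauchySeq_tendsto_of_complete (Metric.cauchySeq_iff'.2 fun e he => ?_)
  obtain ⟨K, hK⟩ := ((hM.tendsto_dist_iter x y).eventually_lt_const he).exists
  refine ⟨K, fun k hk => ?_⟩
  obtain ⟨l, rfl⟩ := Nat.exists_eq_add_of_le hk
  refine lt_of_le_of_lt (hM.dist_iter_le x y (iter M x y K).1 _ K ?_ ?_ l).1 hK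
  · simp
  · rw [dist_comm]

lemma dist_iter_iter_le (hM : IsConicalMidpoint M) (x y x' y' : X) (k : ℕ) :
    dist (iter M x y (k + 1)).1 (iter M x' y' (k + 1)).1 ≤ (dist x x' + dist y y') / 2 ∧
    dist (iter M x y (k + 1)).2 (iter M x' y' (k + 1)).2 ≤ (dist x x' + dist y y') / 2 := by
  induction k with
  | zero =>
    exact ⟨hM.2 x y x' y', (hM.2 y x y' x').trans_eq (by ring)⟩
  | succ k ih =>
    obtain ⟨h1, h2⟩ := ih
    rw [iter.eq_2 M x y (k + 1), iter.eq_2 M x' y' (k + 1)]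
    constructor
    · refine (hM.2 _ _ _ _).trans ?_
      linarith
    · refine (hM.2 _ _ _ _).trans ?_
      linarith

/-- In a complete space a conical midpoint map can be made symmetric. -/
theorem exists_symmetric [CompleteSpace X] (hM : IsConicalMidpoint M) :
    ∃ N : X → X → X, IsConicalMidpoint N ∧ ∀ x y, N x y = N y x := by
  choose N hN using hM.exists_tendsto_iter
  refine ⟨N, ⟨fun x => ?_, fun x y x' y' => ?_⟩, fun x y => ?_⟩
  · have h : ∀ k, iter M x x k = (x, x) := by
      intro k
      induction k with
      | zero => rfl
      | succ k ih => simp [iter, ih, hM.1]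
    refine tendsto_nhds_unique (hN x x) ?_
    simp [h]
  · have h := ((hN x y).comp (Filter.tendsto_add_atTop_nat 1)).dist
      ((hN x' y').comp (Filter.tendsto_add_atTop_nat 1))
    exact le_of_tendsto' h fun k => (hM.dist_iter_iter_le x y x' y' k).1
  · have h := (hN x y).dist (hN y x)
    simp only [iter_swap M x y, Prod.fst_swap] at h
    exact dist_eq_zero.1 (tendsto_nhds_unique h (hM.tendsto_dist_iter x y))

end IsConicalMidpoint

section Smoothing

variable {X V : Type*} [MetricSpace X] [AddCommGroup V] [Module ℝ V]

/-- `g'` is an averaged version of `g`, with averages taken over distance at most `s`: pointwise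
estimates for `g` on `s`-balls are inherited by `g'`. -/
def IsSmoothing (ν : Seminorm ℝ V) (s : ℝ) (g g' : V → X) : Prop :=
  (∀ x h C, (∀ x', ν (x' - x) ≤ s → dist (g x') (g (x' + h)) ≤ C) →
    dist (g' x) (g' (x + h)) ≤ C) ∧
  ∀ x z C, (∀ x', ν (x' - x) ≤ s → dist (g x') z ≤ C) → dist (g' x) z ≤ C

lemma IsSmoothing.refl (ν : Seminorm ℝ V) (g : V → X) {s : ℝ} (hs : 0 ≤ s) :
    IsSmoothing ν s g g :=
  ⟨fun x h C H => H x (by simpa using hs), fun x z C H => H x (by simpa using hs)⟩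

lemma IsSmoothing.trans {ν : Seminorm ℝ V} {s t : ℝ} {g g' g'' : V → X}
    (h : IsSmoothing ν s g g') (h' : IsSmoothing ν t g' g'') : IsSmoothing ν (s + t) g g'' := by
  have key : ∀ x x' x'', ν (x' - x) ≤ t → ν (x'' - x') ≤ s → ν (x'' - x) ≤ s + t := by
    intro x x' x'' h1 h2
    have := map_add_le_add ν (x'' - x') (x' - x)
    rw [sub_add_sub_cancel] at this
    linarith
  exact ⟨fun x v C H => h'.1 x v C fun x' hx' => h.1 x' v C fun x'' hx'' => H x'' (key _ _ _ hx' hx''),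
    fun x z C H => h'.2 x z C fun x' hx' => h.2 x' z C fun x'' hx'' => H x'' (key _ _ _ hx' hx'')⟩

lemma IsConicalMidpoint.isSmoothing {N : X → X → X} (hN : IsConicalMidpoint N)
    (ν : Seminorm ℝ V) (u : V) (g : V → X) :
    IsSmoothing ν (ν u) g fun x => N (g x) (g (x + u)) := by
  constructor
  · intro x h C H
    refine (hN.2 _ _ _ _).trans ?_
    have h1 := H x (by simp)
    have h2 := H (x + u) (by simp)
    rw [add_right_comm] at h2
    linarith
  · intro x z C H
    refine (hN.dist_right_le _ _ _).trans ?_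
    linarith [H x (by simp), H (x + u) (by simp)]

/-- Smoothing along `u` turns a bound on steps `2 ^ j • u` into a bound on steps `u`. -/
lemma exists_smoothing_direction {N : X → X → X} (hN : IsConicalMidpoint N)
    (hsymm : ∀ x y, N x y = N y x) (ν : Seminorm ℝ V) (u : V) (j : ℕ) (g : V → X) :
    ∃ g' : V → X, IsSmoothing ν (2 ^ j * ν u) g g' ∧
      ∀ x C, (∀ x', ν (x' - x) ≤ 2 ^ j * ν u → dist (g x') (g (x' + (2:ℝ) ^ j • u)) ≤ C) →
        dist (g' x) (g' (x + u)) ≤ C / 2 ^ j := by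
  induction j generalizing g with
  | zero =>
    refine ⟨g, IsSmoothing.refl ν g (by simp), fun x C H => ?_⟩
    simpa using H x (by simp)
  | succ j ih =>
    set w : V := (2:ℝ) ^ j • u with hw
    have hνw : ν w = 2 ^ j * ν u := by simp [hw, map_smul_eq_mul]
    obtain ⟨g', h1, h2⟩ := ih fun x => N (g x) (g (x + w))
    refine ⟨g', ?_, fun x C H => ?_⟩
    · have := (hN.isSmoothing ν w g).trans h1
      rw [hνw] at this
      convert this using 1
      ring
    · have h3 := h2 x (C / 2) fun x' hx' => ?_
      · rw [pow_succ, mul_comm, ← div_div]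
        exact h3
      · have h4 := hN.2 (g (x' + w)) (g x') (g (x' + w)) (g (x' + w + w))
        have h5 := H x' (hx'.trans (by
          rw [pow_succ]
          nlinarith [apply_nonneg ν u, show (0:ℝ) < 2 ^ j by positivity]))
        have h6 : x' + (2:ℝ) ^ (j + 1) • u = x' + w + w := by
          rw [hw, pow_succ, mul_smul, two_smul, smul_add, add_assoc]
        rw [h6] at h5
        rw [dist_self, hsymm (g (x' + w)) (g x')] at h4
        linarith

lemma exists_smoothing {N : X → X → X} (hN : IsConicalMidpoint N)
    (hsymm : ∀ x y, N x y = N y x) (ν : Seminorm ℝ V) {ι : Type*} (s : Finset ι) (u : ι → V)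
    (j : ℕ) (g : V → X) :
    ∃ g' : V → X, IsSmoothing ν (2 ^ j * ∑ i ∈ s, ν (u i)) g g' ∧
      ∀ i ∈ s, ∀ x C, (∀ x', ν (x' - x) ≤ 2 ^ j * ∑ i ∈ s, ν (u i) →
          dist (g x') (g (x' + (2:ℝ) ^ j • u i)) ≤ C) →
        dist (g' x) (g' (x + u i)) ≤ C / 2 ^ j := by
  classical
  induction s using Finset.induction_on with
  | empty => exact ⟨g, IsSmoothing.refl ν g (by simp), by simp⟩
  | insert i s his ih =>
    obtain ⟨g₁, h1, h2⟩ := ih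
    obtain ⟨g', h3, h4⟩ := exists_smoothing_direction hN hsymm ν (u i) j g₁
    have hsum : (2:ℝ) ^ j * ∑ i ∈ insert i s, ν (u i) =
        2 ^ j * ∑ i ∈ s, ν (u i) + 2 ^ j * ν (u i) := by
      rw [Finset.sum_insert his]; ring
    have key : ∀ x x' x'', ν (x' - x) ≤ 2 ^ j * ν (u i) →
        ν (x'' - x') ≤ 2 ^ j * ∑ i ∈ s, ν (u i) →
        ν (x'' - x) ≤ 2 ^ j * ∑ i ∈ insert i s, ν (u i) := by
      intro x x' x'' ha hb
      have := map_add_le_add ν (x'' - x') (x' - x)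
      rw [sub_add_sub_cancel] at this
      linarith
    refine ⟨g', hsum ▸ h1.trans h3, fun l hl x C H => ?_⟩
    rcases Finset.mem_insert.1 hl with rfl | hl
    · exact h4 x C fun x' hx' => h1.1 x' _ C fun x'' hx'' => H x'' (key _ _ _ hx' hx'')
    · exact h3.1 x _ _ fun x' hx' => h2 l hl x' C fun x'' hx'' => H x'' (key _ _ _ hx' hx'')

end Smoothing

/-- If each `φ i` has average at most `κ` along every segment of `M` steps `u i`, some lattice
point makes the sum of all `φ i` at most `κ` times their number. -/
lemma exists_sum_le_of_average_le {V ι : Type*} [AddCommGroup V] [Module ℝ V] [Fintype ι]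
    (u : ι → V) (φ : ι → V → ℝ) (κ : ℝ) (M : ℕ) (hM : 0 < M)
    (h : ∀ i, ∀ a : ι → Fin M, a i = ⟨0, hM⟩ →
      ∑ m ∈ Finset.range M, φ i (∑ l, (a l : ℝ) • u l + (m : ℝ) • u i) ≤ M * κ) :
    ∃ a : ι → Fin M, ∑ i, φ i (∑ l, (a l : ℝ) • u l) ≤ Fintype.card ι * κ := by
  classical
  have : Nonempty (Fin M) := ⟨⟨0, hM⟩⟩
  have main : ∀ i, ∑ a : ι → Fin M, φ i (∑ l, (a l : ℝ) • u l) ≤ ∑ _a : ι → Fin M, κ := by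
    intro i
    rw [← (Equiv.funSplitAt i (Fin M)).symm.sum_comp,
      ← (Equiv.funSplitAt i (Fin M)).symm.sum_comp (fun _ => κ),
      Fintype.sum_prod_type_right, Fintype.sum_prod_type_right]
    refine Finset.sum_le_sum fun c _ => ?_
    have h1 := h i ((Equiv.funSplitAt i (Fin M)).symm (⟨0, hM⟩, c)) (by simp)
    rw [Finset.sum_range] at h1
    simp only [Finset.sum_const, Finset.card_univ, Fintype.card_fin, nsmul_eq_mul]
    refine le_trans (le_of_eq (Finset.sum_congr rfl fun m _ => ?_)) h1
    congr 1
    rw [Fintype.sum_eq_add_sum_compl i, Fintype.sum_eq_add_sum_compl i]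
    have h2 : ∀ l ∈ ({i} : Finset ι)ᶜ,
        ((((Equiv.funSplitAt i (Fin M)).symm (m, c)) l : ℕ) : ℝ) • u l =
        ((((Equiv.funSplitAt i (Fin M)).symm (⟨0, hM⟩, c)) l : ℕ) : ℝ) • u l := by
      intro l hl
      have : l ≠ i := by simpa using hl
      simp [this]
    rw [Finset.sum_congr rfl h2]
    simp [add_comm]
  obtain ⟨a, -, ha⟩ := Finset.exists_le_of_sum_le (s := (Finset.univ : Finset (ι → Fin M)))
    (f := fun a => ∑ i, φ i (∑ l, (a l : ℝ) • u l)) (g := fun _ => Fintype.card ι * κ)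
    Finset.univ_nonempty (by
      rw [Finset.sum_comm]
      refine (Finset.sum_le_sum fun i _ => main i).trans_eq ?_
      simp only [Finset.sum_const, Finset.card_univ, nsmul_eq_mul]
      ring)
  exact ⟨a, ha⟩

/-- A map on a large ball that is isometric up to an error `θ * 2 ^ j` gives a map that is
isometric up to a small error at unit scale, on finitely many pairs of points. -/
lemma exists_almost_isometric {X V ι : Type*} [MetricSpace X] [AddCommGroup V] [Module ℝ V]
    [Fintype ι] {N : X → X → X} (hN : IsConicalMidpoint N) (hsymm : ∀ x y, N x y = N y x)
    (ν : Seminorm ℝ V) (b u : ι → V) (S B θ R : ℝ) (hS : S = ∑ i, ν (u i))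
    (hB : ∀ i, ν (b i) ≤ B) (hθ : 0 ≤ θ) (L j : ℕ) (hL : 0 < L)
    (hR : (L + 3) * S * 2 ^ j + B ≤ R) (Φ : V → X)
    (hΦ : ∀ x y, ν x ≤ R → ν y ≤ R → |dist (Φ x) (Φ y) - ν (x - y)| ≤ θ * 2 ^ j) :
    ∃ f : V → X, ∀ i, dist (f (b i)) (f (b i + u i)) ≤ ν (u i) + θ ∧
      ν (u i) - Fintype.card ι * (4 * θ + 2 * S / L) ≤ dist (f (b i)) (f (b i + u i)) := by
  obtain ⟨g, hg, hstep⟩ := exists_smoothing hN hsymm ν Finset.univ u j Φ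
  rw [← hS] at hg hstep
  set T : ℝ := 2 ^ j with hT
  have hT0 : 0 < T := by positivity
  have hL0 : (1:ℝ) ≤ L := by exact_mod_cast hL
  have huS : ∀ i, ν (u i) ≤ S := fun i => hS ▸
    Finset.single_le_sum (f := fun i => ν (u i)) (fun i _ => apply_nonneg ν _) (Finset.mem_univ i)
  have hS0 : 0 ≤ S := hS ▸ Finset.sum_nonneg fun i _ => apply_nonneg ν _
  have hTS : 0 ≤ T * S := by positivity
  have htri : ∀ x x', ν x' ≤ ν (x' - x) + ν x := fun x x' => by
    simpa using map_add_le_add ν (x' - x) x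
  -- one-step upper bound
  have hup : ∀ i x, ν x ≤ R - 2 * (T * S) → dist (g x) (g (x + u i)) ≤ ν (u i) + θ := by
    intro i x hx
    have h1 := hstep i (Finset.mem_univ i) x (T * ν (u i) + θ * T) fun x' hx' => ?_
    · refine h1.trans_eq ?_
      field_simp
    · have h2 : ν (T • u i) = T * ν (u i) := by
        rw [map_smul_eq_mul, Real.norm_of_nonneg hT0.le]
      have h3 : T * ν (u i) ≤ T * S := by gcongr; exact huS i
      have h4 := htri x x'
      have h5 := map_add_le_add ν x' (T • u i)
      have h6 := (abs_le.1 (hΦ x' (x' + T • u i) (by linarith) (by linarith))).2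
      rw [sub_add_cancel_left, map_neg_eq_map] at h6
      linarith
  -- closeness to `Φ`
  have hclose : ∀ x, ν x ≤ R - T * S → dist (g x) (Φ x) ≤ T * S + θ * T := by
    intro x hx
    refine hg.2 x _ _ fun x' hx' => ?_
    have h4 := htri x x'
    have h6 := (abs_le.1 (hΦ x' x (by linarith) (by linarith))).2
    linarith
  set M : ℕ := L * 2 ^ j with hMdef
  have hM : 0 < M := by positivity
  have hMT : (M:ℝ) = L * T := by simp [hMdef, hT]
  have hcomb : ∀ c : ι → ℝ, (∀ l, |c l| ≤ M) → ν (∑ l, c l • u l) ≤ L * (T * S) := by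
    intro c hc
    calc ν (∑ l, c l • u l) ≤ ∑ l, ν (c l • u l) :=
          Finset.le_sum_of_subadditive ν (map_zero ν).le (map_add_le_add ν) _ _
      _ ≤ ∑ l, L * T * ν (u l) := by
          refine Finset.sum_le_sum fun l _ => ?_
          rw [map_smul_eq_mul, Real.norm_eq_abs, ← hMT]
          gcongr
          exact hc l
      _ = L * (T * S) := by rw [← Finset.mul_sum, hS, mul_assoc]
  have hlat : ∀ a : ι → Fin M, ν (∑ l, (a l : ℝ) • u l) ≤ L * (T * S) := fun a =>
    hcomb _ fun l => by
      rw [abs_of_nonneg (Nat.cast_nonneg _)]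
      exact_mod_cast (a l).2.le
  -- the defect of a step, with an average bound
  have hmid : ∀ i, ∀ p, ν p ≤ L * (T * S) → ν (b i + p) ≤ R - 3 * (T * S) := by
    intro i p hp
    have := map_add_le_add ν (b i) p
    have := hB i
    linarith
  have htot : ∀ i, ∀ a : ι → Fin M, a i = ⟨0, hM⟩ → ν (∑ l, (a l : ℝ) • u l + (M:ℝ) • u i)
      ≤ L * (T * S) := by
    intro i a hai
    classical
    have h1 : ∑ l, (a l : ℝ) • u l + (M:ℝ) • u i =
        ∑ l, (if l = i then (M:ℝ) else (a l : ℝ)) • u l := by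
      rw [Fintype.sum_eq_add_sum_compl i, Fintype.sum_eq_add_sum_compl i, hai]
      have h2 : ∀ l ∈ ({i} : Finset ι)ᶜ, (if l = i then (M:ℝ) else (a l : ℝ)) • u l =
          (a l : ℝ) • u l := by
        intro l hl
        have : l ≠ i := by simpa using hl
        simp [this]
      rw [Finset.sum_congr rfl h2]
      simp [add_comm]
    rw [h1]
    refine hcomb _ fun l => ?_
    split_ifs
    · rw [abs_of_nonneg (Nat.cast_nonneg _)]
    · rw [abs_of_nonneg (Nat.cast_nonneg _)]
      exact_mod_cast (a l).2.le
  obtain ⟨a, ha⟩ := exists_sum_le_of_average_le u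
    (fun i p => ν (u i) + θ - dist (g (b i + p)) (g (b i + p + u i)))
    (4 * θ + 2 * S / L) M hM (by
      intro i a hai
      set p := ∑ l, (a l : ℝ) • u l with hp
      have h1 := dist_le_range_sum_dist (fun m : ℕ => g (b i + (p + (m:ℝ) • u i))) M
      have h2 : ∀ m : ℕ, b i + (p + ((m + 1 : ℕ) : ℝ) • u i) =
          b i + (p + (m:ℝ) • u i) + u i := by
        intro m; push_cast; rw [add_smul, one_smul]; abel
      simp only [h2] at h1
      rw [Finset.sum_sub_distrib]
      simp only [Nat.cast_zero, zero_smul, add_zero, Finset.sum_const, Finset.card_range,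
        nsmul_eq_mul] at h1 ⊢
      have h3 := hmid i p (hlat a)
      have h4 := hmid i _ (htot i a hai)
      have h5 := hclose (b i + p) (by linarith)
      have h6 := hclose _ (show ν (b i + (p + (M:ℝ) • u i)) ≤ R - T * S by linarith)
      have h7 := (abs_le.1 (hΦ (b i + p) (b i + (p + (M:ℝ) • u i)) (by linarith)
        (by linarith))).1
      have h8 : ν (b i + p - (b i + (p + (M:ℝ) • u i))) = M * ν (u i) := by
        rw [← add_assoc, sub_add_cancel_left, map_neg_eq_map, map_smul_eq_mul,
          Real.norm_of_nonneg (Nat.cast_nonneg _)]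
      rw [h8] at h7
      have h9 := dist_triangle4 (Φ (b i + p)) (g (b i + p)) (g (b i + (p + (M:ℝ) • u i)))
        (Φ (b i + (p + (M:ℝ) • u i)))
      rw [dist_comm (Φ (b i + p)) (g (b i + p))] at h9
      have h10 : (M:ℝ) * (4 * θ + 2 * S / L) = M * θ + 3 * (L * T * θ) + 2 * (T * S) := by
        rw [hMT]; field_simp; ring
      have h11 : 3 * (1 * T * θ) ≤ 3 * (L * T * θ) := by gcongr
      linarith)
  set p := ∑ l, (a l : ℝ) • u l with hp
  have hup' : ∀ i, dist (g (b i + p)) (g (b i + p + u i)) ≤ ν (u i) + θ := fun i =>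
    hup i _ (by linarith [hmid i p (hlat a)])
  refine ⟨fun x => g (x + p), fun i => ?_⟩
  beta_reduce
  rw [add_right_comm (b i) (u i) p]
  refine ⟨hup' i, ?_⟩
  have h1 := Finset.single_le_sum
    (f := fun i => ν (u i) + θ - dist (g (b i + p)) (g (b i + p + u i)))
    (fun i _ => by linarith [hup' i]) (Finset.mem_univ i)
  linarith

/-- Isometric embeddings into a proper space with cocompact isometry group can be found by
approximating on finite sets. -/
lemma exists_isometric_of_finite_approx {X V : Type*} [MetricSpace X] [ProperSpace X]
    [AddCommGroup V] [Module ℝ V] (hcc : CocompactIsometryGroup X) (ν : Seminorm ℝ V)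
    (h : ∀ (F : Finset V) (η : ℝ), 0 < η → ∃ f : V → X, ∀ x ∈ F, ∀ y ∈ F,
      |dist (f x) (f y) - ν (x - y)| ≤ η) :
    ∃ f : V → X, ∀ x y, dist (f x) (f y) = ν (x - y) := by
  classical
  obtain ⟨D, -, hD⟩ := hcc
  obtain ⟨f₀, -⟩ := h ∅ 1 one_pos
  set o := f₀ 0
  set K : Set (V → X) := Set.univ.pi fun x => Metric.closedBall o (D + ν x + 1) with hK
  have hKc : IsCompact K := isCompact_univ_pi fun x => isCompact_closedBall _ _
  let C : V × V × {η : ℝ // 0 < η} → Set (V → X) := fun q =>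
    {f | |dist (f q.1) (f q.2.1) - ν (q.1 - q.2.1)| ≤ q.2.2}
  have hC : ∀ q, IsClosed (C q) := fun q => by
    refine isClosed_le ?_ continuous_const
    fun_prop
  obtain ⟨f, -, hf⟩ := hKc.inter_iInter_nonempty C hC (by
    intro s
    set F : Finset V := insert 0 (s.image (fun q => q.1) ∪ s.image fun q => q.2.1) with hF
    obtain ⟨η, hη0, hη1, hη⟩ : ∃ η : ℝ, 0 < η ∧ η ≤ 1 ∧ ∀ q ∈ s, η ≤ q.2.2 := by
      have hne : (insert (1:ℝ) (s.image fun q => (q.2.2 : ℝ))).Nonempty :=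
        Finset.insert_nonempty _ _
      refine ⟨(insert (1:ℝ) (s.image fun q => (q.2.2 : ℝ))).min' hne, ?_, ?_, ?_⟩
      · rw [Finset.lt_min'_iff]
        intro y hy
        rcases Finset.mem_insert.1 hy with rfl | hy
        · exact one_pos
        · obtain ⟨q, -, rfl⟩ := Finset.mem_image.1 hy
          exact q.2.2.2
      · exact Finset.min'_le _ _ (Finset.mem_insert_self _ _)
      · intro q hq
        exact Finset.min'_le _ _ (Finset.mem_insert_of_mem (Finset.mem_image_of_mem _ hq))
    obtain ⟨f, hf⟩ := h F η hη0
    obtain ⟨γ, hγ⟩ := hD (f 0) o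
    have h0 : (0:V) ∈ F := Finset.mem_insert_self _ _
    refine ⟨fun x => if x ∈ F then γ (f x) else o, ?_, ?_⟩
    · intro x _
      simp only [Metric.mem_closedBall]
      split_ifs with hx
      · have h1 := (abs_le.1 (hf x hx 0 h0)).2
        have h2 := dist_triangle (γ (f x)) (γ (f 0)) o
        rw [γ.isometry.dist_eq] at h2
        rw [sub_zero] at h1
        linarith
      · have := apply_nonneg ν x
        have := dist_nonneg.trans hγ
        rw [dist_self]; linarith
    · refine Set.mem_iInter₂.2 fun q hq => ?_
      have hq1 : q.1 ∈ F := Finset.mem_insert_of_mem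
        (Finset.mem_union_left _ (Finset.mem_image_of_mem (fun q => q.1) hq))
      have hq2 : q.2.1 ∈ F := Finset.mem_insert_of_mem
        (Finset.mem_union_right _ (Finset.mem_image_of_mem (fun q => q.2.1) hq))
      simp only [C, Set.mem_ofPred_eq, hq1, hq2, if_true, γ.isometry.dist_eq]
      exact (hf _ hq1 _ hq2).trans (hη q hq))
  refine ⟨f, fun x y => ?_⟩
  have h1 : ∀ η : ℝ, 0 < η → |dist (f x) (f y) - ν (x - y)| ≤ 0 + η := fun η hη => by
    rw [zero_add]
    exact Set.mem_iInter.1 hf (x, y, ⟨η, hη⟩)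
  have h2 := abs_nonpos_iff.1 (le_of_forall_pos_le_add h1)
  linarith

/-- A dyadic scale `2 ^ j` that is a small multiple of `R k` but much larger than `R k * ε k`. -/
lemma exists_dyadic_scale {R ε : ℕ → ℝ} (hRinf : Filter.Tendsto R Filter.atTop Filter.atTop)
    (hε0 : Filter.Tendsto ε Filter.atTop (nhds 0)) (A B θ : ℝ) (hA : 0 ≤ A)
    (hθ : 0 < θ) : ∃ k j : ℕ, A * 2 ^ j + B ≤ R k ∧ R k * ε k ≤ θ * 2 ^ j := by
  set δ : ℝ := 1 / (2 * (A + 1)) with hδ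
  have hδ0 : 0 < δ := by positivity
  have e1 := hRinf.eventually_ge_atTop (2 * B)
  have e2 := hRinf.eventually_ge_atTop (1 / δ)
  have e3 := hε0.eventually_le_const (show 0 < θ * δ / 2 by positivity)
  obtain ⟨k, h1, h2, h3⟩ := (e1.and (e2.and e3)).exists
  have hR0 : 0 < R k := lt_of_lt_of_le (by positivity) h2
  rw [div_le_iff₀ hδ0] at h2
  obtain ⟨j, h4, h5⟩ := exists_nat_pow_near h2 one_lt_two
  refine ⟨k, j, ?_, ?_⟩
  · have h6 : A * 2 ^ j ≤ A * (R k * δ) := by gcongr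
    have h7 : A * (R k * δ) ≤ R k / 2 := by
      rw [hδ]
      have : A / (A + 1) ≤ 1 := by rw [div_le_one (by positivity)]; linarith
      calc A * (R k * (1 / (2 * (A + 1)))) = R k / 2 * (A / (A + 1)) := by field_simp
        _ ≤ R k / 2 * 1 := by gcongr
        _ = _ := mul_one _
    linarith
  · calc R k * ε k ≤ R k * (θ * δ / 2) := by gcongr
      _ = θ / 2 * (R k * δ) := by ring
      _ ≤ θ / 2 * 2 ^ (j + 1) := by gcongr
      _ = θ * 2 ^ j := by ring

/-- If `X` is a proper metric space with a conical geodesic bicombing and cocompact isometry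
group, and there is a relative Hausdorff approximation `Φ k : B(R k) → X` (with `R k → ∞`,
`ε k → 0`) for the norm `ν` on `ℝ^n`, then `(ℝ^n, ν)` embeds isometrically into `X`. -/
theorem stmt1 {X : Type*} [MetricSpace X] [ProperSpace X]
    (σ : X → X → ℝ → X) (hσ : IsConicalBicombing σ)
    (hcc : CocompactIsometryGroup X)
    {n : ℕ} (ν : (Fin n → ℝ) → ℝ) (hν : IsNorm ν)
    (R : ℕ → ℝ) (ε : ℕ → ℝ) (hRpos : ∀ k, 0 < R k) (hεpos : ∀ k, 0 < ε k)
    (hRinf : Filter.Tendsto R Filter.atTop Filter.atTop)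
    (hε0 : Filter.Tendsto ε Filter.atTop (nhds 0))
    (Φ : ℕ → (Fin n → ℝ) → X)
    (hΦ : ∀ k, ∀ x y : Fin n → ℝ, ν x ≤ R k → ν y ≤ R k →
      |dist (Φ k x) (Φ k y) - ν (x - y)| ≤ R k * ε k) :
    ∃ f : (Fin n → ℝ) → X, ∀ x y, dist (f x) (f y) = ν (x - y) := by
  classical
  obtain ⟨-, -, hσ3, hσ4⟩ := id hσ
  have hσ0 := hσ.1
  have hmid : (1/2:ℝ) ∈ Set.Icc (0:ℝ) 1 := by constructor <;> norm_num
  have hM : IsConicalMidpoint fun x y => σ x y (1/2) := by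
    refine ⟨fun x => ?_, fun x y x' y' => (hσ4 x y x' y' _ hmid).trans_eq (by ring)⟩
    have h := hσ3 x x (1/2) hmid 0 (by simp)
    rw [dist_self, mul_zero, dist_eq_zero, hσ0] at h
    exact h
  obtain ⟨N, hN, hsymm⟩ := hM.exists_symmetric
  let μ : Seminorm ℝ (Fin n → ℝ) := Seminorm.of ν hν.2.1 fun c x => hν.2.2 c x
  have hμ : ∀ x, μ x = ν x := fun _ => rfl
  refine exists_isometric_of_finite_approx hcc μ fun F η hη => ?_
  let b : F × F → (Fin n → ℝ) := fun q => q.1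
  let u : F × F → (Fin n → ℝ) := fun q => (q.2 : Fin n → ℝ) - q.1
  set S := ∑ i, μ (u i) with hS
  have hS0 : 0 ≤ S := Finset.sum_nonneg fun i _ => apply_nonneg μ _
  set c : ℝ := ((Fintype.card (F × F) : ℕ) : ℝ) with hc
  have hc0 : 0 ≤ c := Nat.cast_nonneg _
  obtain ⟨L, hL⟩ := exists_nat_gt (c * (2 * S) / (η / 2))
  have hL0 : (0:ℝ) < L := lt_of_le_of_lt (by positivity) hL
  set θ := η / (8 * (c + 1)) with hθ
  have hθ0 : 0 < θ := by positivity
  obtain ⟨k, j, h1, h2⟩ := exists_dyadic_scale hRinf hε0 ((L + 3) * S) (∑ i, μ (b i)) θ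
    (by positivity) hθ0
  obtain ⟨f, hf⟩ := exists_almost_isometric hN hsymm μ b u S (∑ i, μ (b i)) θ (R k) hS
    (fun i => Finset.single_le_sum (f := fun i => μ (b i)) (fun i _ => apply_nonneg μ _)
      (Finset.mem_univ i)) hθ0.le L j (by exact_mod_cast hL0) h1 (Φ k)
    (fun x y hx hy => (hΦ k x y hx hy).trans h2)
  have h3 : θ * (8 * (c + 1)) = η := by rw [hθ]; field_simp
  have h4 : c * (2 * S / L) ≤ η / 2 := by
    rw [div_lt_iff₀ (by positivity)] at hL
    rw [← mul_div_assoc, div_le_iff₀ hL0]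
    linarith
  have h5 : 0 ≤ θ * c := by positivity
  refine ⟨f, fun x hx y hy => ?_⟩
  obtain ⟨h6, h7⟩ := hf (⟨x, hx⟩, ⟨y, hy⟩)
  simp only [b, u, add_sub_cancel] at h6 h7
  rw [map_sub_rev μ y x] at h6 h7
  rw [abs_le]
  constructor <;> linarith
end

section
/- If a proper metric space X admits a conical geodesic bicombing σ, then X admits a reversible conical geodesic bicombing σ̃, i.e., one additionally satisfying σ̃(x,y,t) = σ̃(y,x,1−t) for all x,y ∈ X and t ∈ [0,1]. -/
open Filter Topology

/-- One step of the symmetrization of a midpoint map `m`. -/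
def midpointStep {X : Type*} (m : X → X → X) (p : X × X) : X × X :=
  (m p.1 p.2, m p.2 p.1)

theorem midpointStep_iterate_swap {X : Type*} (m : X → X → X) (p : X × X) (n : ℕ) :
    (midpointStep m)^[n] p.swap = ((midpointStep m)^[n] p).swap :=
  (Function.Semiconj.iterate_right (f := Prod.swap)
    (ga := midpointStep m) (gb := midpointStep m) (fun _ => rfl) n p).symm

theorem midpointStep_iterate_self {X : Type*} {m : X → X → X} (hself : ∀ a, m a a = a)
    (a : X) (n : ℕ) : (midpointStep m)^[n] (a, a) = (a, a) :=
  Function.iterate_fixed (by simp [midpointStep, hself]) n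

section MidpointMap

variable {X : Type*} [MetricSpace X] {m : X → X → X}

theorem antitone_dist_midpointStep_iterate
    (hm : ∀ a b a' b', dist (m a b) (m a' b') ≤ (dist a a' + dist b b') / 2) (p : X × X) :
    Antitone fun n => dist ((midpointStep m)^[n] p).1 ((midpointStep m)^[n] p).2 := by
  refine antitone_nat_of_succ_le fun n => ?_
  rw [Function.iterate_succ_apply']
  set q := (midpointStep m)^[n] p
  have h := hm q.1 q.2 q.2 q.1
  rw [dist_comm q.2 q.1] at h
  simp only [midpointStep]
  linarith

theorem dist_midpointStep_iterate_le
    (hm : ∀ a b a' b', dist (m a b) (m a' b') ≤ (dist a a' + dist b b') / 2)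
    (p q : X × X) (n : ℕ) (hn : n ≠ 0) :
    dist ((midpointStep m)^[n] p).1 ((midpointStep m)^[n] q).1
        ≤ (dist p.1 q.1 + dist p.2 q.2) / 2 ∧
      dist ((midpointStep m)^[n] p).2 ((midpointStep m)^[n] q).2
        ≤ (dist p.1 q.1 + dist p.2 q.2) / 2 := by
  induction n, Nat.one_le_iff_ne_zero.2 hn using Nat.le_induction with
  | base =>
    refine ⟨hm _ _ _ _, (hm _ _ _ _).trans_eq ?_⟩
    rw [add_comm]
  | succ n h ih =>
    obtain ⟨h₁, h₂⟩ := ih (by omega)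
    rw [Function.iterate_succ_apply', Function.iterate_succ_apply']
    exact ⟨(hm _ _ _ _).trans (by linarith), (hm _ _ _ _).trans (by linarith)⟩

theorem dist_midpointStep_iterate_start_le
    (hm : ∀ a b a' b', dist (m a b) (m a' b') ≤ (dist a a' + dist b b') / 2)
    (hself : ∀ a, m a a = a) (p : X × X) (n : ℕ) (hn : n ≠ 0) :
    dist p.1 ((midpointStep m)^[n] p).1 ≤ dist p.1 p.2 / 2 ∧
      dist p.2 ((midpointStep m)^[n] p).1 ≤ dist p.1 p.2 / 2 := by
  have h₁ := (dist_midpointStep_iterate_le hm (p.1, p.1) p n hn).1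
  have h₂ := (dist_midpointStep_iterate_le hm (p.2, p.2) p n hn).1
  rw [midpointStep_iterate_self hself] at h₁ h₂
  simpa [dist_comm p.2 p.1] using And.intro h₁ h₂

theorem dist_midpointStep_iterate_start_eq
    (hm : ∀ a b a' b', dist (m a b) (m a' b') ≤ (dist a a' + dist b b') / 2)
    (hself : ∀ a, m a a = a) (p : X × X) (n : ℕ) (hn : n ≠ 0) :
    dist p.1 ((midpointStep m)^[n] p).1 = dist p.1 p.2 / 2 := by
  obtain ⟨h₁, h₂⟩ := dist_midpointStep_iterate_start_le hm hself p n hn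
  have := dist_triangle_right p.1 p.2 ((midpointStep m)^[n] p).1
  linarith

theorem dist_midpointStep_iterate_eq
    (hm : ∀ a b a' b', dist (m a b) (m a' b') ≤ (dist a a' + dist b b') / 2)
    (hself : ∀ a, m a a = a) (p : X × X) {k n : ℕ} (hkn : k < n) :
    dist ((midpointStep m)^[k] p).1 ((midpointStep m)^[n] p).1 =
      dist ((midpointStep m)^[k] p).1 ((midpointStep m)^[k] p).2 / 2 := by
  rw [← dist_midpointStep_iterate_start_eq hm hself _ (n - k) (by omega),
    ← Function.iterate_add_apply, Nat.sub_add_cancel hkn.le]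

/-- In a proper space the two iterated midpoint sequences cannot stay apart: otherwise their
terms would form an infinite bounded separated set. -/
theorem tendsto_dist_midpointStep_iterate [ProperSpace X]
    (hm : ∀ a b a' b', dist (m a b) (m a' b') ≤ (dist a a' + dist b b') / 2)
    (hself : ∀ a, m a a = a) (p : X × X) :
    Tendsto (fun n => dist ((midpointStep m)^[n] p).1 ((midpointStep m)^[n] p).2)
      atTop (𝓝 0) := by
  have hbdd (n : ℕ) : ((midpointStep m)^[n] p).1 ∈ Metric.closedBall p.1 (dist p.1 p.2 / 2) := by
    rcases eq_or_ne n 0 with rfl | hn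
    · exact Metric.mem_closedBall_self (by positivity)
    · rw [Metric.mem_closedBall, dist_comm]
      exact (dist_midpointStep_iterate_start_le hm hself p n hn).1
  obtain ⟨l, -, φ, hφ, hl⟩ :=
    (isCompact_closedBall p.1 (dist p.1 p.2 / 2)).tendsto_subseq hbdd
  refine Metric.tendsto_atTop.2 fun ε hε => ?_
  obtain ⟨N, hN⟩ := Metric.cauchySeq_iff.1 hl.cauchySeq (ε / 2) (by positivity)
  have h := hN N le_rfl (N + 1) N.le_succ
  simp only [Function.comp_apply] at h
  rw [dist_midpointStep_iterate_eq hm hself p (hφ N.lt_succ_self)] at h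
  refine ⟨φ N, fun n hn => ?_⟩
  rw [Real.dist_0_eq_abs, abs_of_nonneg dist_nonneg]
  have := antitone_dist_midpointStep_iterate hm p hn
  simp only at this
  linarith

theorem exists_tendsto_midpointStep_iterate [ProperSpace X]
    (hm : ∀ a b a' b', dist (m a b) (m a' b') ≤ (dist a a' + dist b b') / 2)
    (hself : ∀ a, m a a = a) (p : X × X) :
    ∃ l, Tendsto (fun n => ((midpointStep m)^[n] p).1) atTop (𝓝 l) ∧
      Tendsto (fun n => ((midpointStep m)^[n] p).2) atTop (𝓝 l) := by
  have hd := tendsto_dist_midpointStep_iterate hm hself p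
  have hc : CauchySeq fun n => ((midpointStep m)^[n] p).1 := by
    refine cauchySeq_of_le_tendsto_0' _ (fun k n hkn => ?_) hd
    rcases hkn.eq_or_lt with rfl | hkn
    · simp
    · rw [dist_midpointStep_iterate_eq hm hself p hkn]
      exact half_le_self dist_nonneg
  obtain ⟨l, hl⟩ := cauchySeq_tendsto_of_complete hc
  exact ⟨l, hl, (tendsto_iff_of_dist hd).1 hl⟩

/-- In a proper space every conical midpoint map can be made symmetric. -/
theorem exists_symmetric_midpoint_map [ProperSpace X]
    (hm : ∀ a b a' b', dist (m a b) (m a' b') ≤ (dist a a' + dist b b') / 2)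
    (hself : ∀ a, m a a = a) :
    ∃ M : X → X → X, (∀ a, M a a = a) ∧ (∀ a b, M a b = M b a) ∧
      ∀ a b a' b', dist (M a b) (M a' b') ≤ (dist a a' + dist b b') / 2 := by
  choose M hM₁ hM₂ using exists_tendsto_midpointStep_iterate hm hself
  refine ⟨fun a b => M (a, b), fun a => ?_, fun a b => ?_, fun a b a' b' => ?_⟩
  · refine tendsto_nhds_unique (hM₁ (a, a)) ?_
    simp only [midpointStep_iterate_self hself]
    exact tendsto_const_nhds
  · refine tendsto_nhds_unique (hM₁ (a, b)) ?_
    have h := hM₂ (a, b).swap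
    simp only [midpointStep_iterate_swap] at h
    exact h
  · refine le_of_tendsto ((hM₁ (a, b)).dist (hM₁ (a', b'))) ?_
    filter_upwards [eventually_ne_atTop 0] with n hn
    exact (dist_midpointStep_iterate_le hm _ _ n hn).1

end MidpointMap

theorem IsConicalBicombing.apply_self {X : Type*} [MetricSpace X] {σ : X → X → ℝ → X}
    (hσ : IsConicalBicombing σ) (x : X) {t : ℝ} (ht : t ∈ Set.Icc (0 : ℝ) 1) :
    σ x x t = x := by
  have h := hσ.2.2.1 x x t ht 0 (by simp)
  rwa [dist_self, mul_zero, dist_eq_zero, hσ.1] at h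

/-- A path joining `f 0` to `f 1` whose Lipschitz constant is at most the distance of its
endpoints has constant speed. -/
theorem dist_eq_of_dist_le_mul_dist {X : Type*} [MetricSpace X] {f : ℝ → X}
    (hf : ∀ t ∈ Set.Icc (0 : ℝ) 1, ∀ t' ∈ Set.Icc (0 : ℝ) 1,
      dist (f t) (f t') ≤ |t - t'| * dist (f 0) (f 1))
    {t t' : ℝ} (ht : t ∈ Set.Icc (0 : ℝ) 1) (ht' : t' ∈ Set.Icc (0 : ℝ) 1) :
    dist (f t) (f t') = |t - t'| * dist (f 0) (f 1) := by
  wlog h : t ≤ t' generalizing t t'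
  · rw [dist_comm, abs_sub_comm]
    exact this ht' ht (le_of_not_ge h)
  refine le_antisymm (hf t ht t' ht') ?_
  have h₀ := hf 0 (by simp) t ht
  have h₁ := hf t' ht' 1 (by simp)
  have htri := dist_triangle4 (f 0) (f t) (f t') (f 1)
  rw [abs_of_nonpos (by linarith [ht.1])] at h₀
  rw [abs_of_nonpos (by linarith [ht'.2])] at h₁
  rw [abs_of_nonpos (by linarith)]
  linarith

/-- **Proposition 1.2.** A proper metric space admitting a conical geodesic bicombing
also admits a reversible conical geodesic bicombing. -/
theorem stmt2 {X : Type*} [MetricSpace X] [ProperSpace X]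
    (σ : X → X → ℝ → X) (hσ : IsConicalBicombing σ) :
    ∃ σ' : X → X → ℝ → X, IsConicalBicombing σ' ∧
      ∀ x y : X, ∀ t ∈ Set.Icc (0:ℝ) 1, σ' x y t = σ' y x (1 - t) := by
  have hhalf : (1 / 2 : ℝ) ∈ Set.Icc (0 : ℝ) 1 := by norm_num
  obtain ⟨M, hself, hcomm, hM⟩ := exists_symmetric_midpoint_map (m := fun a b => σ a b (1 / 2))
    (fun a b a' b' => (hσ.2.2.2 a b a' b' _ hhalf).trans_eq (by ring))
    (fun a => hσ.apply_self a hhalf)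
  obtain ⟨hσ₀, hσ₁, hσd, hσc⟩ := hσ
  have hmem {t : ℝ} (ht : t ∈ Set.Icc (0 : ℝ) 1) : 1 - t ∈ Set.Icc (0 : ℝ) 1 :=
    ⟨by linarith [ht.2], by linarith [ht.1]⟩
  have h₀ (x y : X) : M (σ x y 0) (σ y x (1 - 0)) = x := by simp [hσ₀, hσ₁, hself]
  have h₁ (x y : X) : M (σ x y 1) (σ y x (1 - 1)) = y := by simp [hσ₀, hσ₁, hself]
  refine ⟨fun x y t => M (σ x y t) (σ y x (1 - t)), ⟨h₀, h₁, ?_, ?_⟩, ?_⟩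
  · intro x y t ht t' ht'
    have key := dist_eq_of_dist_le_mul_dist (f := fun t => M (σ x y t) (σ y x (1 - t))) ?_ ht ht'
    · simpa only [h₀, h₁] using key
    · intro t ht t' ht'
      simp only [h₀, h₁]
      refine (hM _ _ _ _).trans_eq ?_
      rw [hσd x y t ht t' ht', hσd y x _ (hmem ht) _ (hmem ht'), dist_comm y x,
        sub_sub_sub_cancel_left, abs_sub_comm t' t]
      ring
  · intro x y x' y' t ht
    have h := hσc x y x' y' t ht
    have h' := hσc y x y' x' (1 - t) (hmem ht)
    exact (hM _ _ _ _).trans (by linarith)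
  · intro x y t _
    simp only [sub_sub_cancel]
    exact hcomm _ _
end

section
/- Let X be a complete metric space with a reversible conical geodesic bicombing σ. Then for every n ∈ ℕ, n ≥ 1, there is a barycenter map bar_n : X^n → X with the following properties: (i) bar_n(x_1,…,x_n) lies in the closed σ-convex hull of {x_1,…,x_n}; (ii) bar_n is permutation invariant: for any permutation π of {1,…,n}, bar_n(x_1,…,x_n) = bar_n(x_{π(1)},…,x_{π(n)}); (iii) γ(bar_n(x_1,…,x_n)) = bar_n(γ(x_1),…,γ(x_n)) for every surjective isometry γ of X for which σ is γ-equivariant; (iv) d(bar_n(x_1,…,x_n), bar_n(y_1,…,y_n)) ≤ min over permutations π of (1/n)·Σ_{i=1}^n d(x_i, y_{π(i)}). -/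
/-- A set `C` is `σ`-convex. -/
def SigmaConvex {X : Type*} [MetricSpace X] (σ : X → X → ℝ → X) (C : Set X) : Prop :=
  ∀ x ∈ C, ∀ y ∈ C, ∀ t ∈ Set.Icc (0:ℝ) 1, σ x y t ∈ C

/-- The closed `σ`-convex hull of `C`: the intersection of all closed `σ`-convex sets
containing `C`. -/
def closedSigmaConvexHull {X : Type*} [MetricSpace X] (σ : X → X → ℝ → X) (C : Set X) :
    Set X :=
  ⋂₀ {D : Set X | C ⊆ D ∧ IsClosed D ∧ SigmaConvex σ D}

/-- The properties of a barycenter map on `n`-tuples, with the contraction estimate stated for the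
identity permutation only. -/
structure IsBarycenterMap {X : Type*} [MetricSpace X] (σ : X → X → ℝ → X) (n : ℕ)
    (bar : (Fin n → X) → X) : Prop where
  mem_hull : ∀ x : Fin n → X, bar x ∈ closedSigmaConvexHull σ (Set.range x)
  perm : ∀ (x : Fin n → X) (π : Equiv.Perm (Fin n)), bar (x ∘ π) = bar x
  equivariant : ∀ γ : X ≃ᵢ X,
    (∀ a b : X, ∀ t ∈ Set.Icc (0:ℝ) 1, γ (σ a b t) = σ (γ a) (γ b) t) →
    ∀ x : Fin n → X, γ (bar x) = bar (fun i => γ (x i))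
  dist_le : ∀ x y : Fin n → X, dist (bar x) (bar y) ≤ (1 / n) * ∑ i, dist (x i) (y i)

/-- Replace each entry of an `(n + 1)`-tuple by the barycenter of the other entries. -/
def barycenterStep {X : Type*} {n : ℕ} (bar : (Fin n → X) → X) (x : Fin (n + 1) → X) :
    Fin (n + 1) → X :=
  fun i => bar (x ∘ i.succAbove)

theorem Fin.exists_perm_comp_succAbove {n : ℕ} (π : Equiv.Perm (Fin (n + 1))) (i : Fin (n + 1)) :
    ∃ ρ : Equiv.Perm (Fin n), ⇑π ∘ i.succAbove = (π i).succAbove ∘ ρ := by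
  have hex : ∀ k, ∃ l, (π i).succAbove l = π (i.succAbove k) := fun k =>
    Fin.exists_succAbove_eq fun h => Fin.succAbove_ne i k (π.injective h)
  choose ρ hρ using hex
  have hinj : Function.Injective ρ := fun a b hab =>
    Fin.succAbove_right_injective (π.injective (by rw [← hρ a, ← hρ b, hab]))
  exact ⟨Equiv.ofBijective ρ (Finite.injective_iff_bijective.mp hinj), funext fun k => (hρ k).symm⟩

section

variable {X : Type*} [MetricSpace X] {σ : X → X → ℝ → X}

theorem closedSigmaConvexHull_singleton (hσ : IsConicalBicombing σ) (z : X) :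
    closedSigmaConvexHull σ {z} = {z} := by
  refine Set.Subset.antisymm (Set.sInter_subset_of_mem ⟨Set.Subset.rfl, isClosed_singleton, ?_⟩)
    (Set.subset_sInter fun D hD => hD.1)
  rintro x rfl y rfl t ht
  have h := hσ.2.2.1 y y t ht 0 (by simp)
  rw [dist_self, mul_zero, hσ.1] at h
  exact dist_eq_zero.mp h

namespace IsBarycenterMap

variable {n : ℕ} {bar : (Fin n → X) → X}

theorem apply_const (hσ : IsConicalBicombing σ) (h : IsBarycenterMap σ n bar) (hn : n ≠ 0)
    (z : X) : bar (fun _ => z) = z := by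
  have : NeZero n := ⟨hn⟩
  have := h.mem_hull fun _ => z
  rwa [Set.range_const, closedSigmaConvexHull_singleton hσ] at this

theorem dist_le_of_forall_le (hσ : IsConicalBicombing σ) (h : IsBarycenterMap σ n bar)
    (hn : n ≠ 0) {x : Fin n → X} {z : X} {C : ℝ} (hC : ∀ i, dist (x i) z ≤ C) :
    dist (bar x) z ≤ C := by
  have hn' : (0 : ℝ) < n := by positivity
  calc dist (bar x) z = dist (bar x) (bar fun _ => z) := by rw [h.apply_const hσ hn]
    _ ≤ (1 / n) * ∑ i, dist (x i) z := h.dist_le _ _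
    _ ≤ (1 / n) * ∑ _i : Fin n, C := by gcongr with i; exact hC i
    _ = C := by simp; field_simp

theorem step_comp_perm (h : IsBarycenterMap σ n bar) (x : Fin (n + 1) → X)
    (π : Equiv.Perm (Fin (n + 1))) :
    barycenterStep bar (x ∘ π) = barycenterStep bar x ∘ π := by
  funext i
  obtain ⟨ρ, hρ⟩ := Fin.exists_perm_comp_succAbove π i
  simp only [barycenterStep, Function.comp_apply]
  rw [Function.comp_assoc, hρ, ← Function.comp_assoc, h.perm]

theorem iterate_step_comp_perm (h : IsBarycenterMap σ n bar) (x : Fin (n + 1) → X)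
    (π : Equiv.Perm (Fin (n + 1))) (m : ℕ) :
    (barycenterStep bar)^[m] (x ∘ π) = (barycenterStep bar)^[m] x ∘ π := by
  induction m with
  | zero => rfl
  | succ m ih => simp only [Function.iterate_succ_apply', ih, h.step_comp_perm]

theorem dist_step_step_le (h : IsBarycenterMap σ n bar) (x : Fin (n + 1) → X)
    (i j : Fin (n + 1)) :
    dist (barycenterStep bar x i) (barycenterStep bar x j) ≤ (1 / n) * dist (x i) (x j) := by
  rcases eq_or_ne i j with rfl | hij
  · simp
  have hswap : barycenterStep bar x j = barycenterStep bar (x ∘ Equiv.swap i j) i := by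
    rw [h.step_comp_perm]; simp
  obtain ⟨k₀, hk₀⟩ := Fin.exists_succAbove_eq hij.symm
  rw [hswap, dist_comm (x i)]
  refine (h.dist_le _ _).trans (mul_le_mul_of_nonneg_left (le_of_eq ?_) (by positivity))
  rw [Finset.sum_eq_single k₀ _ (by simp)]
  · simp [hk₀]
  · intro k _ hk
    have hkj : i.succAbove k ≠ j := fun e => hk (Fin.succAbove_right_injective (e.trans hk₀.symm))
    simp [Equiv.swap_apply_of_ne_of_ne (Fin.succAbove_ne i k) hkj]

theorem dist_iterate_step_le (h : IsBarycenterMap σ n bar) (hn : 2 ≤ n) {x : Fin (n + 1) → X}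
    {C : ℝ} (hC : ∀ i j, dist (x i) (x j) ≤ C) (m : ℕ) (i j : Fin (n + 1)) :
    dist ((barycenterStep bar)^[m] x i) ((barycenterStep bar)^[m] x j) ≤ C * (1 / 2) ^ m := by
  induction m with
  | zero => simpa using hC i j
  | succ m ih =>
    have hn' : (1 : ℝ) / n ≤ 1 / 2 :=
      one_div_le_one_div_of_le two_pos (by exact_mod_cast hn)
    simp only [Function.iterate_succ_apply']
    calc _ ≤ (1 / n : ℝ) * _ := h.dist_step_step_le _ i j
      _ ≤ (1 / 2) * (C * (1 / 2) ^ m) := by gcongr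
      _ = C * (1 / 2) ^ (m + 1) := by ring

theorem exists_tendsto_iterate_step [CompleteSpace X] (hσ : IsConicalBicombing σ)
    (h : IsBarycenterMap σ n bar) (hn : 2 ≤ n) (x : Fin (n + 1) → X) :
    ∃ L, ∀ i, Filter.Tendsto (fun m => (barycenterStep bar)^[m] x i) Filter.atTop (nhds L) := by
  obtain ⟨C, hC⟩ : ∃ C, ∀ i j, dist (x i) (x j) ≤ C :=
    ⟨Metric.diam (Set.range x), fun i j => Metric.dist_le_diam_of_mem
      (Set.finite_range x).isBounded (Set.mem_range_self i) (Set.mem_range_self j)⟩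
  have hd := h.dist_iterate_step_le hn hC
  have hcau : CauchySeq fun m => (barycenterStep bar)^[m] x 0 := by
    refine cauchySeq_of_le_geometric (1 / 2) C (by norm_num) fun m => ?_
    rw [dist_comm, Function.iterate_succ_apply']
    exact h.dist_le_of_forall_le hσ (by lia) fun i => hd m _ 0
  obtain ⟨L, hL⟩ := cauchySeq_tendsto_of_complete hcau
  refine ⟨L, fun i => hL.congr_dist ?_⟩
  refine squeeze_zero (fun _ => dist_nonneg) (fun m => hd m 0 i) ?_
  simpa using (tendsto_pow_atTop_nhds_zero_of_lt_one (r := (1 / 2 : ℝ)) (by norm_num)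
    (by norm_num)).const_mul C

theorem iterate_step_mem (h : IsBarycenterMap σ n bar) {D : Set X} (hD : IsClosed D)
    (hconv : SigmaConvex σ D) {x : Fin (n + 1) → X} (hx : Set.range x ⊆ D) (m : ℕ)
    (i : Fin (n + 1)) : (barycenterStep bar)^[m] x i ∈ D := by
  induction m generalizing i with
  | zero => exact hx (Set.mem_range_self i)
  | succ m ih =>
    rw [Function.iterate_succ_apply']
    refine h.mem_hull _ D ⟨?_, hD, hconv⟩
    rintro _ ⟨k, rfl⟩
    exact ih _

theorem iterate_step_equivariant (h : IsBarycenterMap σ n bar) (γ : X ≃ᵢ X)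
    (hγ : ∀ a b : X, ∀ t ∈ Set.Icc (0:ℝ) 1, γ (σ a b t) = σ (γ a) (γ b) t)
    (x : Fin (n + 1) → X) (m : ℕ) :
    (barycenterStep bar)^[m] (fun i => γ (x i)) =
      fun i => γ ((barycenterStep bar)^[m] x i) := by
  induction m with
  | zero => rfl
  | succ m ih =>
    simp only [Function.iterate_succ_apply', ih]
    funext i
    exact (h.equivariant γ hγ _).symm

theorem sum_dist_step_le (h : IsBarycenterMap σ n bar) (hn : n ≠ 0) (x y : Fin (n + 1) → X) :
    ∑ i, dist (barycenterStep bar x i) (barycenterStep bar y i) ≤ ∑ i, dist (x i) (y i) := by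
  have hn' : (0 : ℝ) < n := by positivity
  calc _ ≤ ∑ i : Fin (n + 1), (1 / n : ℝ) *
        ∑ k, dist (x (i.succAbove k)) (y (i.succAbove k)) :=
        Finset.sum_le_sum fun i _ => h.dist_le _ _
    _ = ∑ i : Fin (n + 1), (1 / n : ℝ) * (∑ j, dist (x j) (y j) - dist (x i) (y i)) := by
        refine Finset.sum_congr rfl fun i _ => ?_
        rw [Fin.sum_univ_succAbove (fun j => dist (x j) (y j)) i, add_sub_cancel_left]
    _ = ∑ i, dist (x i) (y i) := by
        rw [← Finset.mul_sum, Finset.sum_sub_distrib, Finset.sum_const, Finset.card_univ,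
          Fintype.card_fin, nsmul_eq_mul]
        push_cast
        field_simp
        ring

theorem sum_dist_iterate_step_le (h : IsBarycenterMap σ n bar) (hn : n ≠ 0)
    (x y : Fin (n + 1) → X) (m : ℕ) :
    ∑ i, dist ((barycenterStep bar)^[m] x i) ((barycenterStep bar)^[m] y i) ≤
      ∑ i, dist (x i) (y i) := by
  induction m with
  | zero => rfl
  | succ m ih =>
    simp only [Function.iterate_succ_apply']
    exact (h.sum_dist_step_le hn _ _).trans ih

theorem exists_succ [CompleteSpace X] (hσ : IsConicalBicombing σ)
    (h : IsBarycenterMap σ n bar) (hn : 2 ≤ n) : ∃ bar', IsBarycenterMap σ (n + 1) bar' := by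
  choose L hL using h.exists_tendsto_iterate_step hσ hn
  refine ⟨L, fun x D hD => ?_, fun x π => ?_, fun γ hγ x => ?_, fun x y => ?_⟩
  · exact hD.2.1.mem_of_tendsto (hL x 0)
      (Filter.Eventually.of_forall fun m => h.iterate_step_mem hD.2.1 hD.2.2 hD.1 m 0)
  · refine tendsto_nhds_unique (hL _ 0) ?_
    simpa only [h.iterate_step_comp_perm, Function.comp_apply] using hL x (π 0)
  · refine tendsto_nhds_unique ((γ.continuous.tendsto _).comp (hL x 0)) ?_
    simpa only [h.iterate_step_equivariant γ hγ, Function.comp_def] using hL (fun i => γ (x i)) 0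
  · have hlim := le_of_tendsto
      (tendsto_finsetSum Finset.univ fun i _ => (hL x i).dist (hL y i))
      (Filter.Eventually.of_forall fun m => h.sum_dist_iterate_step_le (by lia) x y m)
    rw [Finset.sum_const, Finset.card_univ, Fintype.card_fin, nsmul_eq_mul] at hlim
    rw [one_div, ← div_eq_inv_mul, le_div_iff₀ (by positivity), mul_comm]
    exact hlim

end IsBarycenterMap

theorem isBarycenterMap_one : IsBarycenterMap σ 1 fun x => x 0 where
  mem_hull x D hD := hD.1 (Set.mem_range_self 0)
  perm x π := by simp [Subsingleton.elim (π 0) 0]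
  equivariant γ _ x := rfl
  dist_le x y := by simp

theorem isBarycenterMap_two (hσ : IsConicalBicombing σ)
    (hrev : ∀ x y : X, ∀ t ∈ Set.Icc (0:ℝ) 1, σ x y t = σ y x (1 - t)) :
    IsBarycenterMap σ 2 fun x => σ (x 0) (x 1) (1 / 2) := by
  have hhalf : (1 / 2 : ℝ) ∈ Set.Icc (0:ℝ) 1 := by norm_num
  refine ⟨fun x D hD => ?_, fun x π => ?_, fun γ hγ x => hγ _ _ _ hhalf, fun x y => ?_⟩
  · exact hD.2.2 _ (hD.1 (Set.mem_range_self 0)) _ (hD.1 (Set.mem_range_self 1)) _ hhalf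
  · have hne : π 0 ≠ π 1 := fun e => zero_ne_one (π.injective e)
    rcases (by lia : π 0 = 0 ∧ π 1 = 1 ∨ π 0 = 1 ∧ π 1 = 0) with ⟨h0, h1⟩ | ⟨h0, h1⟩
    · simp [h0, h1]
    · simp only [Function.comp_apply, h0, h1]
      rw [hrev _ _ _ hhalf]
      norm_num
  · refine (hσ.2.2.2 _ _ _ _ _ hhalf).trans (le_of_eq ?_)
    rw [Fin.sum_univ_two]
    push_cast
    ring

theorem exists_isBarycenterMap [CompleteSpace X] (hσ : IsConicalBicombing σ)
    (hrev : ∀ x y : X, ∀ t ∈ Set.Icc (0:ℝ) 1, σ x y t = σ y x (1 - t)) {n : ℕ} (hn : 1 ≤ n) :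
    ∃ bar, IsBarycenterMap σ n bar := by
  rcases hn.eq_or_lt with rfl | hn2
  · exact ⟨_, isBarycenterMap_one⟩
  induction n, hn2 using Nat.le_induction with
  | base => exact ⟨_, isBarycenterMap_two hσ hrev⟩
  | succ n hn2 ih =>
    obtain ⟨bar, h⟩ := ih (one_le_two.trans hn2)
    exact h.exists_succ hσ hn2

end

/-- **Theorem 2.1.** Existence of barycenter maps `bar_n : X^n → X` on a complete metric
space with a reversible conical geodesic bicombing. -/
theorem stmt5 {X : Type*} [MetricSpace X] [CompleteSpace X]
    (σ : X → X → ℝ → X) (hσ : IsConicalBicombing σ)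
    (hrev : ∀ x y : X, ∀ t ∈ Set.Icc (0:ℝ) 1, σ x y t = σ y x (1 - t))
    (n : ℕ) (hn : 1 ≤ n) :
    ∃ bar : (Fin n → X) → X,
      (∀ x : Fin n → X, bar x ∈ closedSigmaConvexHull σ (Set.range x)) ∧
      (∀ (x : Fin n → X) (π : Equiv.Perm (Fin n)), bar (x ∘ π) = bar x) ∧
      (∀ γ : X ≃ᵢ X,
        (∀ a b : X, ∀ t ∈ Set.Icc (0:ℝ) 1, γ (σ a b t) = σ (γ a) (γ b) t) →
        ∀ x : Fin n → X, γ (bar x) = bar (fun i => γ (x i))) ∧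
      (∀ x y : Fin n → X, ∀ π : Equiv.Perm (Fin n),
        dist (bar x) (bar y) ≤ (1 / n) * ∑ i, dist (x i) (y (π i))) := by
  obtain ⟨bar, h⟩ := exists_isBarycenterMap hσ hrev hn
  refine ⟨bar, h.mem_hull, h.perm, h.equivariant, fun x y π => ?_⟩
  rw [← h.perm y π]
  exact h.dist_le x (y ∘ π)
end

section
/- Let X be a metric space and let (bar_m)_{m≥1}, bar_m : X^m → X, be a family of maps satisfying: bar_m(x,…,x) = x for all x ∈ X; permutation invariance; the contraction property d(bar_m(x_1,…,x_m), bar_m(y_1,…,y_m)) ≤ (1/m)·Σ_{i=1}^m d(x_i,y_i); and, for m ≥ 2, the recursion bar_m(x_1,…,x_m) = bar_m(x_1^1,…,x_m^1) where x_j^1 = bar_{m−1}(x_1,…,x̂_j,…,x_m) (entry x_j omitted). Then for every x ∈ X, every n-tuple (x_1,…,x_n) and integers 1 ≤ k ≤ n: d(x, bar_n(x_1,…,x_n)) ≤ C(n,k)^{−1} · Σ_{I ⊆ {1,…,n}, |I|=k} d(x, bar_k(x|_I)), where bar_k(x|_I) denotes the barycenter of the k-tuple with entries x_i for i ∈ I,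 and C(n,k) is the binomial coefficient. -/
open Finset in
/-- Each `k`-subset of `Fin (n + 1)` misses exactly `n + 1 - k` points, so it is counted
`n + 1 - k` times when summing over the `k`-subsets of all the faces of `Fin (n + 1)`. -/
lemma sum_sum_powersetCard_map_succAboveEmb {n k : ℕ} (g : Finset (Fin (n + 1)) → ℝ) :
    ∑ j : Fin (n + 1), ∑ I ∈ (univ : Finset (Fin n)).powersetCard k, g (I.map j.succAboveEmb) =
      ((n + 1 - k : ℕ) : ℝ) * ∑ J ∈ (univ : Finset (Fin (n + 1))).powersetCard k, g J := by
  have face (j : Fin (n + 1)) :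
      ∑ I ∈ (univ : Finset (Fin n)).powersetCard k, g (I.map j.succAboveEmb) =
        ∑ J ∈ (univ : Finset (Fin (n + 1))).powersetCard k, if j ∉ J then g J else 0 := by
    have hmap : ((univ : Finset (Fin n)).map j.succAboveEmb).powersetCard k =
        ((univ : Finset (Fin (n + 1))).powersetCard k).filter (fun J => j ∉ J) := by
      ext J
      simp only [mem_powersetCard, mem_filter, subset_univ, true_and]
      rw [and_comm]
      refine and_congr_right fun _ => ⟨fun h hj => ?_, fun h i hi => ?_⟩
      · obtain ⟨i, -, hi⟩ := mem_map.mp (h hj)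
        exact j.succAbove_ne i hi
      · obtain ⟨l, hl⟩ := Fin.exists_succAbove_eq (x := i) (y := j) (fun e => h (e ▸ hi))
        exact mem_map.mpr ⟨l, mem_univ _, hl⟩
    rw [← sum_filter, ← hmap, powersetCard_map, sum_map]
    rfl
  simp_rw [face]
  rw [sum_comm, mul_sum]
  refine sum_congr rfl fun J hJ => ?_
  rw [← sum_filter, sum_const, nsmul_eq_mul]
  congr 2
  have hfilter : (univ : Finset (Fin (n + 1))).filter (fun j => j ∉ J) = Jᶜ := by
    ext j
    simp
  rw [hfilter, card_compl, (mem_powersetCard.mp hJ).2, Fintype.card_fin]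

/-- The value of `f` on the subtuple of `x` indexed by `I`, listed in increasing order, and `0`
if `I` does not have `k` elements. -/
noncomputable def subtupleValue {X : Type*} {n k : ℕ} (f : (Fin k → X) → ℝ) (x : Fin n → X)
    (I : Finset (Fin n)) : ℝ :=
  if h : I.card = k then f (x ∘ I.orderEmbOfFin h) else 0

lemma subtupleValue_map_succAboveEmb {X : Type*} {n k : ℕ} (f : (Fin k → X) → ℝ)
    (x : Fin (n + 1) → X) (j : Fin (n + 1)) (I : Finset (Fin n)) :
    subtupleValue f x (I.map j.succAboveEmb) = subtupleValue f (x ∘ j.succAbove) I := by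
  unfold subtupleValue
  by_cases h : I.card = k
  · have h' : (I.map j.succAboveEmb).card = k := by rw [Finset.card_map, h]
    rw [dif_pos h, dif_pos h', Function.comp_assoc]
    congr 2
    refine (Finset.orderEmbOfFin_unique h' (fun i => ?_) ?_).symm
    · exact Finset.mem_map.mpr ⟨_, Finset.orderEmbOfFin_mem I h i, rfl⟩
    · exact j.strictMono_succAbove.comp (I.orderEmbOfFin h).strictMono
  · rw [dif_neg h, dif_neg (by rwa [Finset.card_map])]

lemma subtupleValue_univ {X : Type*} {k : ℕ} (f : (Fin k → X) → ℝ) (x : Fin k → X) :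
    subtupleValue f x Finset.univ = f x := by
  have h : (Finset.univ : Finset (Fin k)).card = k := Finset.card_fin k
  unfold subtupleValue
  rw [dif_pos h, ← Finset.orderEmbOfFin_unique (f := id) h (fun _ => Finset.mem_univ _)
    strictMono_id, Function.comp_id]

/-- A nonexpansive-average estimate over the faces of a tuple propagates to all `k`-subtuples. -/
lemma le_average_subtupleValue {X : Type*} (f : ∀ m : ℕ, (Fin m → X) → ℝ)
    (hf : ∀ m : ℕ, 1 ≤ m → ∀ x : Fin (m + 1) → X,
      f (m + 1) x ≤ (1 / ((m + 1 : ℕ) : ℝ)) * ∑ j : Fin (m + 1), f m (x ∘ j.succAbove))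
    {n k : ℕ} (hk : 1 ≤ k) (hkn : k ≤ n) (x : Fin n → X) :
    f n x ≤ ((n.choose k : ℝ))⁻¹ *
      ∑ I ∈ (Finset.univ : Finset (Fin n)).powersetCard k, subtupleValue (f k) x I := by
  induction n, hkn using Nat.le_induction with
  | base =>
    have huniv : (Finset.univ : Finset (Fin k)).powersetCard k = {Finset.univ} := by
      simpa using Finset.powersetCard_self (Finset.univ : Finset (Fin k))
    simp [huniv, subtupleValue_univ]
  | succ n hkn ih =>
    have hchoose : (n.choose k : ℝ) * ((n + 1 : ℕ) : ℝ) =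
        ((n + 1).choose k : ℝ) * ((n + 1 - k : ℕ) : ℝ) := by
      exact_mod_cast Nat.choose_mul_succ_eq n k
    have h₁ : (n.choose k : ℝ) ≠ 0 := by exact_mod_cast (Nat.choose_pos hkn).ne'
    have h₂ : ((n + 1).choose k : ℝ) ≠ 0 := by
      exact_mod_cast (Nat.choose_pos (hkn.trans n.le_succ)).ne'
    have h₃ : ((n + 1 : ℕ) : ℝ) ≠ 0 := by exact_mod_cast n.succ_ne_zero
    calc f (n + 1) x
        ≤ (1 / ((n + 1 : ℕ) : ℝ)) * ∑ j : Fin (n + 1), f n (x ∘ j.succAbove) :=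
          hf n (hk.trans hkn) x
      _ ≤ (1 / ((n + 1 : ℕ) : ℝ)) * ∑ j : Fin (n + 1), ((n.choose k : ℝ))⁻¹ *
            ∑ I ∈ (Finset.univ : Finset (Fin n)).powersetCard k,
              subtupleValue (f k) x (I.map j.succAboveEmb) := by
          refine mul_le_mul_of_nonneg_left (Finset.sum_le_sum fun j _ => ?_) (by positivity)
          simp_rw [subtupleValue_map_succAboveEmb]
          exact ih _
      _ = _ := by
          rw [← Finset.mul_sum, sum_sum_powersetCard_map_succAboveEmb, ← mul_assoc, ← mul_assoc]
          congr 1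
          field_simp
          linarith


/-- **Lemma 2.3.** For a family of barycenter maps satisfying the diagonal, permutation
invariance, contraction, and recursion properties, the distance from any point `p` to
`bar_n (x_1, …, x_n)` is bounded by the average over all `k`-element subsets `I` of
`{1, …, n}` of the distance from `p` to `bar_k (x|_I)`. -/
theorem stmt6 {X : Type*} [MetricSpace X]
    (bar : ∀ m : ℕ, (Fin m → X) → X)
    (hdiag : ∀ m : ℕ, 1 ≤ m → ∀ x : X, bar m (fun _ => x) = x)
    (hperm : ∀ (m : ℕ) (x : Fin m → X) (π : Equiv.Perm (Fin m)),
      bar m (x ∘ π) = bar m x)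
    (hcontr : ∀ m : ℕ, 1 ≤ m → ∀ x y : Fin m → X,
      dist (bar m x) (bar m y) ≤ (1 / m) * ∑ i, dist (x i) (y i))
    (hrec : ∀ m : ℕ, 1 ≤ m → ∀ x : Fin (m + 1) → X,
      bar (m + 1) x = bar (m + 1) (fun j => bar m (fun i => x (j.succAbove i))))
    {n : ℕ} (x : Fin n → X) {k : ℕ} (hk1 : 1 ≤ k) (hkn : k ≤ n) (p : X) :
    dist p (bar n x) ≤ ((n.choose k : ℝ))⁻¹ *
      ∑ I ∈ ((Finset.univ : Finset (Fin n)).powersetCard k).attach,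
        dist p (bar k (fun i =>
          x (I.1.orderIsoOfFin (Finset.mem_powersetCard.mp I.2).2 i))) := by
  have hf (m : ℕ) (_ : 1 ≤ m) (y : Fin (m + 1) → X) : dist p (bar (m + 1) y) ≤
      (1 / ((m + 1 : ℕ) : ℝ)) * ∑ j : Fin (m + 1), dist p (bar m (y ∘ j.succAbove)) := by
    have h := hcontr (m + 1) m.succ_pos (fun _ => p) (fun j => bar m (y ∘ j.succAbove))
    rw [hdiag (m + 1) m.succ_pos] at h
    rw [hrec m ‹_› y]
    exact h
  refine (le_average_subtupleValue (fun m y => dist p (bar m y)) hf hk1 hkn x).trans_eq ?_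
  rw [← Finset.sum_attach]
  congr 1
  refine Finset.sum_congr rfl fun I _ => ?_
  exact dif_pos (Finset.mem_powersetCard.mp I.2).2
end

section
/- Let X be a complete metric space with a reversible conical geodesic bicombing, let ‖·‖ be a norm on ℝ^n, and suppose there are sequences R_k → ∞, ε_k → 0 of positive reals and maps Φ_k : B(R_k) → X (where B(R) = {z ∈ ℝ^n : ‖z‖ ≤ R}) satisfying |d(Φ_k(x),Φ_k(y)) − ‖x−y‖| ≤ R_k·ε_k for all x,y ∈ B(R_k). Then there exist a constant L ≥ 0, sequences R'_k → ∞ and ε'_k → 0 of positive reals, and maps Φ̃_k : B(R'_k) → X that are L-Lipschitz and satisfy |d(Φ̃_k(x),Φ̃_k(y)) − ‖x−y‖| ≤ R'_k·ε'_k for all x,y ∈ B(R'_k). -/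
section Interpolation

variable {X : Type*} [MetricSpace X] {σ : X → X → ℝ → X}

/-- Piecewise geodesic interpolation of a sequence of points indexed by the integers. -/
noncomputable def bicombingInterp (σ : X → X → ℝ → X) (f : ℤ → X) (s : ℝ) : X :=
  σ (f ⌊s⌋) (f (⌊s⌋ + 1)) (Int.fract s)

theorem bicombingInterp_intCast (hσ : IsConicalBicombing σ) (f : ℤ → X) (m : ℤ) :
    bicombingInterp σ f m = f m := by
  simp [bicombingInterp, hσ.1]

theorem dist_bicombingInterp_le (hσ : IsConicalBicombing σ) {f g : ℤ → X} {C : ℝ}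
    (h : ∀ m, dist (f m) (g m) ≤ C) (s : ℝ) :
    dist (bicombingInterp σ f s) (bicombingInterp σ g s) ≤ C := by
  have h0 := Int.fract_nonneg s
  have h1 := (Int.fract_lt_one s).le
  refine (hσ.2.2.2 _ _ _ _ _ ⟨h0, h1⟩).trans ?_
  nlinarith [mul_le_mul_of_nonneg_left (h ⌊s⌋) (sub_nonneg.2 h1),
    mul_le_mul_of_nonneg_left (h (⌊s⌋ + 1)) h0]

theorem dist_int_le_of_succ {f : ℤ → X} {K : ℝ} (h : ∀ m, dist (f m) (f (m + 1)) ≤ K)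
    (m : ℤ) (k : ℕ) : dist (f m) (f (m + k)) ≤ K * k := by
  induction k with
  | zero => simp
  | succ k ih =>
    have h1 := dist_triangle (f m) (f (m + k)) (f (m + k + 1))
    have h2 := h (m + k)
    push_cast
    rw [← add_assoc]
    linarith

theorem dist_bicombingInterp_of_floor_eq (hσ : IsConicalBicombing σ) {f : ℤ → X} {K : ℝ}
    (h : ∀ m, dist (f m) (f (m + 1)) ≤ K) {s t : ℝ} (hst : ⌊s⌋ = ⌊t⌋) :
    dist (bicombingInterp σ f s) (bicombingInterp σ f t) ≤ K * |s - t| := by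
  have hfr : Int.fract s - Int.fract t = s - t := by
    rw [Int.fract, Int.fract, hst]; ring
  unfold bicombingInterp
  rw [hst, hσ.2.2.1 _ _ _ ⟨Int.fract_nonneg s, (Int.fract_lt_one s).le⟩ _
    ⟨Int.fract_nonneg t, (Int.fract_lt_one t).le⟩, hfr, mul_comm]
  exact mul_le_mul_of_nonneg_right (h _) (abs_nonneg _)

theorem dist_bicombingInterp_floor_add_one (hσ : IsConicalBicombing σ) {f : ℤ → X} {K : ℝ}
    (h : ∀ m, dist (f m) (f (m + 1)) ≤ K) (s : ℝ) :
    dist (bicombingInterp σ f s) (f (⌊s⌋ + 1)) ≤ K * (⌊s⌋ + 1 - s) := by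
  have h1 := (Int.fract_lt_one s).le
  conv_lhs => rw [← hσ.2.1 (f ⌊s⌋) (f (⌊s⌋ + 1))]
  unfold bicombingInterp
  rw [hσ.2.2.1 _ _ _ ⟨Int.fract_nonneg s, h1⟩ _ ⟨zero_le_one, le_rfl⟩, abs_sub_comm,
    abs_of_nonneg (sub_nonneg.2 h1), mul_comm]
  have : (⌊s⌋ : ℝ) + 1 - s = 1 - Int.fract s := by rw [Int.fract]; ring
  rw [this]
  exact mul_le_mul_of_nonneg_right (h _) (sub_nonneg.2 h1)

theorem dist_bicombingInterp_le_mul (hσ : IsConicalBicombing σ) {f : ℤ → X} {K : ℝ}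
    (h : ∀ m, dist (f m) (f (m + 1)) ≤ K) (s t : ℝ) :
    dist (bicombingInterp σ f s) (bicombingInterp σ f t) ≤ K * |s - t| := by
  wlog hst : s ≤ t generalizing s t
  · rw [dist_comm, abs_sub_comm]
    exact this t s (le_of_not_ge hst)
  rcases (Int.floor_mono hst).eq_or_lt with heq | hlt
  · exact dist_bicombingInterp_of_floor_eq hσ h heq
  obtain ⟨k, hk⟩ := Int.le.dest (Int.add_one_le_of_lt hlt)
  have h1 := dist_bicombingInterp_floor_add_one hσ h s
  have h2 := dist_int_le_of_succ h (⌊s⌋ + 1) k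
  have h3 := dist_bicombingInterp_of_floor_eq hσ h (s := ⌊t⌋) (t := t) (by simp)
  rw [bicombingInterp_intCast hσ, abs_sub_comm,
    abs_of_nonneg (sub_nonneg.2 (Int.floor_le t))] at h3
  rw [hk] at h2
  have hk' : (⌊s⌋ : ℝ) + 1 + k = ⌊t⌋ := by exact_mod_cast hk
  have h4 := dist_triangle4 (bicombingInterp σ f s) (f (⌊s⌋ + 1)) (f ⌊t⌋)
    (bicombingInterp σ f t)
  rw [abs_sub_comm, abs_of_nonneg (sub_nonneg.2 hst)]
  calc _ ≤ K * (⌊s⌋ + 1 - s) + K * k + K * (t - ⌊t⌋) := by linarith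
    _ = K * (t - s) := by rw [← hk']; ring

end Interpolation

section Lattice

variable {X : Type*} [MetricSpace X] {σ : X → X → ℝ → X} {ι : Type*} [DecidableEq ι]

/-- A map on the integer lattice that moves neighbours by at most `K` extends to a map on all of
`ι → ℝ` that is `K`-Lipschitz in the coordinates of `s` and still moves neighbours in the other
coordinate directions by at most `K`. -/
theorem exists_lattice_extension_of_finset (hσ : IsConicalBicombing σ) {K : ℝ}
    (G : (ι → ℤ) → X)
    (hG : ∀ z i, dist (G z) (G (Function.update z i (z i + 1))) ≤ K) (s : Finset ι) :
    ∃ F : (ι → ℝ) → X, (∀ z : ι → ℤ, F (fun i => z i) = G z) ∧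
      (∀ i ∈ s, ∀ (x : ι → ℝ) (a b : ℝ),
        dist (F (Function.update x i a)) (F (Function.update x i b)) ≤ K * |a - b|) ∧
      (∀ i ∉ s, ∀ (x : ι → ℝ) (m : ℤ),
        dist (F (Function.update x i (m : ℝ))) (F (Function.update x i ((m + 1 : ℤ) : ℝ))) ≤ K) := by
  induction s using Finset.induction_on with
  | empty =>
    refine ⟨fun x => G (fun i => ⌊x i⌋), by simp, by simp, fun i _ x m => ?_⟩
    have key : ∀ m : ℤ, (fun j => ⌊Function.update x i (m : ℝ) j⌋)
        = Function.update (fun j => ⌊x j⌋) i m := by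
      intro m
      ext j
      by_cases hj : j = i
      · subst hj; simp
      · simp [hj]
    have := hG (Function.update (fun j => ⌊x j⌋) i m) i
    simp only [key]
    simpa using this
  | insert j s hj ih =>
    obtain ⟨F, hFG, hLip, hnb⟩ := ih
    refine ⟨fun x => bicombingInterp σ (fun m : ℤ => F (Function.update x j (m : ℝ))) (x j),
      fun z => ?_, fun i hi x a b => ?_, fun i hi x m => ?_⟩
    · beta_reduce
      rw [bicombingInterp_intCast hσ, ← hFG z]
      congr 1
      exact Function.update_eq_self j (fun i => (z i : ℝ))
    · by_cases hij : i = j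
      · subst hij
        simp only [Function.update_self, Function.update_idem]
        exact dist_bicombingInterp_le_mul hσ (hnb i hj x) a b
      · have hi' : i ∈ s := (Finset.mem_insert.1 hi).resolve_left hij
        simp only [Function.update_of_ne (Ne.symm hij), Function.update_comm hij]
        refine dist_bicombingInterp_le hσ (fun m => ?_) _
        exact hLip i hi' _ a b
    · rw [Finset.mem_insert, not_or] at hi
      simp only [Function.update_of_ne (Ne.symm hi.1)]
      refine dist_bicombingInterp_le hσ (fun l => ?_) _
      simp only [Function.update_comm hi.1]
      exact hnb i hi.2 _ m

theorem dist_le_sum_of_update [Fintype ι] {F : (ι → ℝ) → X} {K : ℝ}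
    (hF : ∀ i (x : ι → ℝ) (a b : ℝ),
      dist (F (Function.update x i a)) (F (Function.update x i b)) ≤ K * |a - b|)
    (x y : ι → ℝ) : dist (F x) (F y) ≤ K * ∑ i, |x i - y i| := by
  have key : ∀ s : Finset ι, dist (F x) (F (s.piecewise y x)) ≤ K * ∑ i ∈ s, |x i - y i| := by
    intro s
    induction s using Finset.induction_on with
    | empty => simp
    | insert j s hj ih =>
      have h := hF j (s.piecewise y x) (x j) (y j)
      have hx : Function.update (s.piecewise y x) j (x j) = s.piecewise y x := by
        conv_rhs => rw [← Function.update_eq_self j (s.piecewise y x)]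
        simp [hj]
      rw [hx] at h
      rw [Finset.piecewise_insert, Finset.sum_insert hj]
      have := dist_triangle (F x) (F (s.piecewise y x))
        (F (Function.update (s.piecewise y x) j (y j)))
      linarith
  simpa using key Finset.univ

theorem exists_lattice_extension [Fintype ι] (hσ : IsConicalBicombing σ) {K : ℝ}
    (G : (ι → ℤ) → X)
    (hG : ∀ z i, dist (G z) (G (Function.update z i (z i + 1))) ≤ K) :
    ∃ F : (ι → ℝ) → X, (∀ z : ι → ℤ, F (fun i => z i) = G z) ∧
      ∀ x y, dist (F x) (F y) ≤ K * ∑ i, |x i - y i| := by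
  obtain ⟨F, h1, h2, -⟩ := exists_lattice_extension_of_finset hσ G hG Finset.univ
  exact ⟨F, h1, dist_le_sum_of_update fun i => h2 i (Finset.mem_univ i)⟩

end Lattice

namespace Seminorm

section Pi

variable {ι : Type*} [Fintype ι] [DecidableEq ι]

theorem le_sum_abs_mul_single (p : Seminorm ℝ (ι → ℝ)) (x : ι → ℝ) :
    p x ≤ ∑ i, |x i| * p (Pi.single i 1) := by
  conv_lhs => rw [pi_eq_sum_univ' x]
  refine (Finset.le_sum_of_subadditive p (map_zero p).le (map_add_le_add p) _ _).trans
    (Finset.sum_le_sum fun i _ => ?_)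
  rw [map_smul_eq_mul, Real.norm_eq_abs]

theorem le_mul_sum_single (p : Seminorm ℝ (ι → ℝ)) {x : ι → ℝ} {C : ℝ} (hx : ∀ i, |x i| ≤ C) :
    p x ≤ C * ∑ i, p (Pi.single i 1) := by
  rw [Finset.mul_sum]
  refine (p.le_sum_abs_mul_single x).trans (Finset.sum_le_sum fun i _ => ?_)
  exact mul_le_mul_of_nonneg_right (hx i) (apply_nonneg p _)

theorem exists_sum_abs_le (p : Seminorm ℝ (ι → ℝ)) (hp : ∀ x, p x = 0 → x = 0) :
    ∃ c : ℝ, 0 ≤ c ∧ ∀ x : ι → ℝ, ∑ i, |x i| ≤ c * p x := by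
  have hcont : Continuous p := by
    have hlip : ∀ x y, dist (p x) (p y) ≤ (∑ i, p (Pi.single i 1)) * dist x y := by
      intro x y
      rw [Real.dist_eq, dist_eq_norm, mul_comm]
      exact (abs_sub_map_le_sub p x y).trans
        (p.le_mul_sum_single fun i => norm_le_pi_norm (x - y) i)
    exact (LipschitzWith.of_dist_le_mul (K := ⟨∑ i, p (Pi.single i 1),
      Finset.sum_nonneg fun i _ => apply_nonneg p _⟩) hlip).continuous
  rcases (Metric.sphere (0 : ι → ℝ) 1).eq_empty_or_nonempty with hS | hS
  · refine ⟨0, le_rfl, fun x => ?_⟩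
    have hx : x = 0 := by
      by_contra hx
      have : ‖x‖⁻¹ • x ∈ Metric.sphere (0 : ι → ℝ) 1 := by
        simp [norm_smul, hx]
      simp [hS] at this
    simp [hx]
  · obtain ⟨u, hu, hmin⟩ := (isCompact_sphere (0 : ι → ℝ) 1).exists_isMinOn hS hcont.continuousOn
    have hu0 : 0 < p u := by
      refine (apply_nonneg p u).lt_of_ne fun h => ?_
      simp [hp u h.symm] at hu
    refine ⟨Fintype.card ι / p u, by positivity, fun x => ?_⟩
    have hx : ‖x‖ ≤ p x / p u := by
      by_cases hx : x = 0
      · simp [hx]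
      have hn : 0 < ‖x‖ := norm_pos_iff.2 hx
      have hmem : ‖x‖⁻¹ • x ∈ Metric.sphere (0 : ι → ℝ) 1 := by
        simp [norm_smul, hx]
      have := isMinOn_iff.1 hmin _ hmem
      rw [map_smul_eq_mul, norm_inv, norm_norm, inv_mul_eq_div, le_div_iff₀ hn] at this
      rw [le_div_iff₀ hu0]
      linarith
    calc ∑ i, |x i| ≤ ∑ _i : ι, ‖x‖ := Finset.sum_le_sum fun i _ => norm_le_pi_norm x i
      _ = Fintype.card ι * ‖x‖ := by simp
      _ ≤ Fintype.card ι * (p x / p u) := by gcongr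
      _ = _ := by ring

end Pi

section Retraction

variable {E : Type*} [AddCommGroup E] [Module ℝ E] (p : Seminorm ℝ E) {R : ℝ}

/-- The radial retraction onto the closed ball of radius `R` about the origin. -/
noncomputable def radialRetraction (R : ℝ) (x : E) : E := (R / max R (p x)) • x

theorem radialRetraction_of_le (hR : 0 < R) {x : E} (hx : p x ≤ R) :
    p.radialRetraction R x = x := by
  rw [radialRetraction, max_eq_left hx, div_self hR.ne', one_smul]

theorem radialRetraction_le (hR : 0 < R) (x : E) : p (p.radialRetraction R x) ≤ R := by
  have hM : 0 < max R (p x) := lt_max_of_lt_left hR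
  rw [radialRetraction, map_smul_eq_mul, Real.norm_of_nonneg (by positivity), div_mul_eq_mul_div,
    div_le_iff₀ hM]
  exact mul_le_mul_of_nonneg_left (le_max_right _ _) hR.le

theorem radialRetraction_sub_le (hR : 0 < R) (x y : E) :
    p (p.radialRetraction R x - p.radialRetraction R y) ≤ 2 * p (x - y) := by
  have hMx : 0 < max R (p x) := lt_max_of_lt_left hR
  have hMy : 0 < max R (p y) := lt_max_of_lt_left hR
  have hd : |max R (p y) - max R (p x)| ≤ p (x - y) := by
    rw [abs_sub_comm, max_comm R, max_comm R]
    exact (abs_max_sub_max_le_abs (p x) (p y) R).trans (abs_sub_map_le_sub p x y)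
  have h1 : R / max R (p x) * p (x - y) ≤ p (x - y) :=
    mul_le_of_le_one_left (apply_nonneg p _) ((div_le_one hMx).2 (le_max_left _ _))
  have h2 : |R / max R (p x) - R / max R (p y)| * p y ≤ p (x - y) := by
    have : R / max R (p x) - R / max R (p y)
        = R / max R (p x) * ((max R (p y) - max R (p x)) / max R (p y)) := by
      field_simp
    rw [this, abs_mul, abs_of_pos (div_pos hR hMx), abs_div, abs_of_pos hMy]
    calc _ = R / max R (p x) * (|max R (p y) - max R (p x)| * (p y / max R (p y))) := by ring
      _ ≤ 1 * (p (x - y) * 1) := by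
        gcongr
        · exact (div_le_one hMx).2 (le_max_left _ _)
        · exact (div_le_one hMy).2 (le_max_right _ _)
      _ = _ := by ring
  have hdec : p.radialRetraction R x - p.radialRetraction R y
      = (R / max R (p x)) • (x - y) + (R / max R (p x) - R / max R (p y)) • y := by
    simp only [radialRetraction, smul_sub, sub_smul]; abel
  rw [hdec]
  refine (map_add_le_add p _ _).trans ?_
  rw [map_smul_eq_mul, map_smul_eq_mul, Real.norm_eq_abs, Real.norm_eq_abs,
    abs_of_nonneg (by positivity : 0 ≤ R / max R (p x))]
  linarith

end Retraction

end Seminorm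

/-- A map on a ball that distorts distances by at most `δ` is close, on the scale `δ`, to a map
that is Lipschitz for the `ℓ¹`-distance. -/
theorem exists_lipschitz_approx {X : Type*} [MetricSpace X] {σ : X → X → ℝ → X}
    (hσ : IsConicalBicombing σ) {ι : Type*} [Fintype ι] [DecidableEq ι]
    (p : Seminorm ℝ (ι → ℝ)) {M : ℝ} (hM : M = ∑ i, p (Pi.single i 1))
    {R δ : ℝ} (hR : 0 < R) (hδ : 0 < δ) (Φ : (ι → ℝ) → X)
    (hΦ : ∀ x y, p x ≤ R → p y ≤ R → |dist (Φ x) (Φ y) - p (x - y)| ≤ δ) :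
    ∃ Ψ : (ι → ℝ) → X, (∀ x y, dist (Ψ x) (Ψ y) ≤ (2 * M + 1) * ∑ i, |x i - y i|) ∧
      ∀ x, p x ≤ R → dist (Ψ x) (Φ x) ≤ (2 * M + 1) * (Fintype.card ι + 1) * δ := by
  set ρ := p.radialRetraction R
  have hM0 : 0 ≤ M := hM ▸ Finset.sum_nonneg fun i _ => apply_nonneg p _
  have hΦρ : ∀ x y, (∀ i, |x i - y i| ≤ δ) →
      dist (Φ (ρ x)) (Φ (ρ y)) ≤ (2 * M + 1) * δ := by
    intro x y hxy
    have h1 := (abs_le.1 (hΦ _ _ (p.radialRetraction_le hR x) (p.radialRetraction_le hR y))).2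
    have h2 := p.radialRetraction_sub_le hR x y
    have h3 := p.le_mul_sum_single (x := x - y) hxy
    rw [← hM] at h3
    linarith
  obtain ⟨F, hFG, hF⟩ := exists_lattice_extension hσ (K := (2 * M + 1) * δ)
    (fun z : ι → ℤ => Φ (ρ fun i => δ * z i)) fun z i => hΦρ _ _ fun j => by
      by_cases hj : j = i
      · subst hj
        simp [mul_add, abs_of_pos hδ]
      · simp [hj, hδ.le]
  refine ⟨fun x => F fun i => x i / δ, fun x y => ?_, fun x hx => ?_⟩
  · refine (hF _ _).trans_eq ?_
    simp only [← sub_div, abs_div, abs_of_pos hδ, ← Finset.sum_div]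
    field_simp
  · have h1 := hF (fun i => x i / δ) (fun i => (⌊x i / δ⌋ : ℝ))
    rw [hFG fun i => ⌊x i / δ⌋] at h1
    have hfr : ∀ i, |x i / δ - ⌊x i / δ⌋| ≤ 1 := fun i => by
      rw [Int.self_sub_floor, abs_of_nonneg (Int.fract_nonneg _)]
      exact (Int.fract_lt_one _).le
    have h2 : ∑ i, |x i / δ - ⌊x i / δ⌋| ≤ Fintype.card ι :=
      (Finset.sum_le_sum fun i _ => hfr i).trans_eq (by simp)
    have h3 := hΦρ (fun i => δ * ⌊x i / δ⌋) x fun i => by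
      have : δ * ⌊x i / δ⌋ - x i = -(δ * (x i / δ - ⌊x i / δ⌋)) := by
        field_simp; ring
      rw [this, abs_neg, abs_mul, abs_of_pos hδ]
      exact mul_le_of_le_one_right hδ.le (hfr i)
    rw [show ρ x = x from p.radialRetraction_of_le hR hx] at h3
    have h4 := mul_le_mul_of_nonneg_left h2 (by positivity : 0 ≤ (2 * M + 1) * δ)
    have h5 := dist_triangle (F fun i => x i / δ) (Φ (ρ fun i => δ * ⌊x i / δ⌋)) (Φ x)
    linarith

/-- **Lemma 3.1 (Step 1).** From a relative Hausdorff approximation into a complete metric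
space with a reversible conical geodesic bicombing, one may construct a relative Hausdorff
approximation consisting of `L`-Lipschitz maps. -/
theorem stmt11 {X : Type*} [MetricSpace X] [CompleteSpace X]
    (σ : X → X → ℝ → X) (hσ : IsConicalBicombing σ)
    (hrev : ∀ x y : X, ∀ t ∈ Set.Icc (0:ℝ) 1, σ x y t = σ y x (1 - t))
    {n : ℕ} (ν : (Fin n → ℝ) → ℝ) (hν : IsNorm ν)
    (R : ℕ → ℝ) (ε : ℕ → ℝ) (hRpos : ∀ k, 0 < R k) (hεpos : ∀ k, 0 < ε k)
    (hRinf : Filter.Tendsto R Filter.atTop Filter.atTop)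
    (hε0 : Filter.Tendsto ε Filter.atTop (nhds 0))
    (Φ : ℕ → (Fin n → ℝ) → X)
    (hΦ : ∀ k, ∀ x y : Fin n → ℝ, ν x ≤ R k → ν y ≤ R k →
      |dist (Φ k x) (Φ k y) - ν (x - y)| ≤ R k * ε k) :
    ∃ (L : ℝ) (R' ε' : ℕ → ℝ) (Φ' : ℕ → (Fin n → ℝ) → X),
      0 ≤ L ∧ (∀ k, 0 < R' k) ∧ (∀ k, 0 < ε' k) ∧
      Filter.Tendsto R' Filter.atTop Filter.atTop ∧
      Filter.Tendsto ε' Filter.atTop (nhds 0) ∧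
      (∀ k, ∀ x y : Fin n → ℝ, ν x ≤ R' k → ν y ≤ R' k →
        dist (Φ' k x) (Φ' k y) ≤ L * ν (x - y)) ∧
      (∀ k, ∀ x y : Fin n → ℝ, ν x ≤ R' k → ν y ≤ R' k →
        |dist (Φ' k x) (Φ' k y) - ν (x - y)| ≤ R' k * ε' k) := by
  classical
  obtain ⟨hν0, hνadd, hνsmul⟩ := hν
  let p : Seminorm ℝ (Fin n → ℝ) := Seminorm.of ν hνadd hνsmul
  obtain ⟨c, hc, hsum⟩ := p.exists_sum_abs_le fun x hx => (hν0 x).1 hx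
  set M := ∑ i, p (Pi.single i 1) with hM
  have hM0 : 0 ≤ M := Finset.sum_nonneg fun i _ => apply_nonneg p _
  choose Ψ hΨ hΨΦ using fun k => exists_lipschitz_approx hσ p hM (hRpos k)
    (mul_pos (hRpos k) (hεpos k)) (Φ k) (hΦ k)
  rw [Fintype.card_fin] at hΨΦ
  refine ⟨(2 * M + 1) * c, R, fun k => (2 * ((2 * M + 1) * (n + 1)) + 1) * ε k, Ψ, by positivity,
    hRpos, fun k => mul_pos (by positivity) (hεpos k), hRinf, ?_, fun k x y _ _ => ?_,
    fun k x y hx hy => ?_⟩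
  · simpa using hε0.const_mul (2 * ((2 * M + 1) * (n + 1)) + 1)
  · rw [mul_assoc]
    exact (hΨ k x y).trans (mul_le_mul_of_nonneg_left (hsum (x - y)) (by positivity))
  · have h1 := hΨΦ k x hx
    have h2 := hΨΦ k y hy
    have h3 := abs_le.1 (hΦ k x y hx hy)
    have h4 := dist_triangle4 (Ψ k x) (Φ k x) (Φ k y) (Ψ k y)
    have h5 := dist_triangle4 (Φ k x) (Ψ k x) (Ψ k y) (Φ k y)
    rw [dist_comm (Φ k y)] at h4
    rw [dist_comm (Φ k x) (Ψ k x)] at h5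
    rw [abs_le]
    constructor <;> linarith
end

section
/- Let X be a proper metric space whose isometry group acts cocompactly, let ‖·‖ be a norm on ℝ^n, and suppose there are sequences R_k → ∞, ε_k → 0 of positive reals and 1-Lipschitz maps Φ_k : B(R_k) → X (where B(R) = {z ∈ ℝ^n : ‖z‖ ≤ R}) satisfying |d(Φ_k(x),Φ_k(y)) − ‖x−y‖| ≤ R_k·ε_k for all x,y ∈ B(R_k). Then there exists an isometric embedding of (ℝ^n,‖·‖) into X. -/
open Filter Topology in
/-- Pointwise limits of almost isometric maps: if every finite set of points can be mapped almost
isometrically into a proper space with cocompact isometry group, then the whole space can be mapped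
isometrically. -/
theorem CocompactIsometryGroup.exists_dist_eq {X E : Type*} [MetricSpace X] [ProperSpace X]
    [Nonempty X] [Zero E] (hcc : CocompactIsometryGroup X) (ρ : E → E → ℝ)
    (h : ∀ (F : Finset E) (δ : ℝ), 0 < δ →
      ∃ f : E → X, ∀ x ∈ F, ∀ y ∈ F, |dist (f x) (f y) - ρ x y| ≤ δ) :
    ∃ f : E → X, ∀ x y, dist (f x) (f y) = ρ x y := by
  classical
  obtain ⟨D, -, hD⟩ := hcc
  obtain ⟨x₀⟩ := ‹Nonempty X›
  choose f hf using fun i : Finset E × ℕ => h i.1 (1 / ((i.2 : ℝ) + 1)) (by positivity)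
  choose γ hγ using fun i : Finset E × ℕ => hD (f i 0) x₀
  set u : Ultrafilter (Finset E × ℕ) := Ultrafilter.of atTop
  have hu : (u : Filter (Finset E × ℕ)) ≤ atTop := Ultrafilter.of_le atTop
  have hmem : ∀ x : E, ∀ᶠ i in (u : Filter (Finset E × ℕ)), x ∈ i.1 := fun x =>
    hu ((eventually_ge_atTop (({x} : Finset E), 0)).mono fun i hi => hi.1 (by simp))
  have hsnd : Tendsto (fun i : Finset E × ℕ => 1 / ((i.2 : ℝ) + 1)) u (𝓝 0) :=
    (tendsto_one_div_add_atTop_nhds_zero_nat.comp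
      (by rw [← prod_atTop_atTop_eq]; exact tendsto_snd)).mono_left hu
  have hlim : ∀ x : E, ∃ l : X, Tendsto (fun i => γ i (f i x)) u (𝓝 l) := by
    intro x
    have hev : ∀ᶠ i in (u : Filter (Finset E × ℕ)),
        γ i (f i x) ∈ Metric.closedBall x₀ (ρ x 0 + 1 + D) := by
      filter_upwards [hmem x, hmem 0] with i hx h0
      have h1 := (abs_le.1 (hf i x hx 0 h0)).2
      have h2 : 1 / ((i.2 : ℝ) + 1) ≤ 1 := by
        rw [div_le_one (by positivity)]
        linarith [(Nat.cast_nonneg i.2 : (0 : ℝ) ≤ i.2)]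
      have h3 := dist_triangle (γ i (f i x)) (γ i (f i 0)) x₀
      rw [(γ i).dist_eq] at h3
      rw [Metric.mem_closedBall]
      linarith [hγ i]
    obtain ⟨l, -, hl⟩ := (isCompact_closedBall x₀ (ρ x 0 + 1 + D)).ultrafilter_le_nhds
      (u.map fun i => γ i (f i x)) (Filter.le_principal_iff.2 hev)
    exact ⟨l, hl⟩
  choose l hl using hlim
  refine ⟨l, fun x y => tendsto_nhds_unique ((hl x).dist (hl y)) ?_⟩
  rw [tendsto_iff_dist_tendsto_zero]
  refine squeeze_zero' (Eventually.of_forall fun _ => dist_nonneg) ?_ hsnd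
  filter_upwards [hmem x, hmem y] with i hx hy
  rw [(γ i).dist_eq, Real.dist_eq]
  exact hf i x hx y hy

/-- If the sums of `g i` along all lines in direction `i` of the cube `ι → Fin N` are at most `C`,
then some point of the cube satisfies the averaged bound for `∑ i, g i`. -/
theorem exists_sum_le_of_sum_update_le {ι : Type*} [Fintype ι] [DecidableEq ι] {N : ℕ}
    (hN : 0 < N) (g : ι → (ι → Fin N) → ℝ) (C : ℝ)
    (h : ∀ i j, ∑ t, g i (Function.update j i t) ≤ C) :
    ∃ j, ∑ i, g i j ≤ Fintype.card ι * C / N := by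
  have : Nonempty (Fin N) := ⟨⟨0, hN⟩⟩
  have hN' : (0 : ℝ) < N := by exact_mod_cast hN
  have hline : ∀ i, ∑ j, g i j * N ≤ ∑ _j : ι → Fin N, C := by
    intro i
    have hinv : Function.Involutive
        (fun q : (ι → Fin N) × Fin N => (Function.update q.1 i q.2, q.1 i)) := by
      rintro ⟨j, t⟩
      simp
    calc ∑ j, g i j * N = ∑ q : (ι → Fin N) × Fin N, g i q.1 := by
          rw [Fintype.sum_prod_type]
          simp [mul_comm]
      _ = ∑ q : (ι → Fin N) × Fin N, g i (Function.update q.1 i q.2) :=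
          (Equiv.sum_comp hinv.toPerm fun q => g i q.1).symm
      _ = ∑ j, ∑ t, g i (Function.update j i t) := Fintype.sum_prod_type _
      _ ≤ _ := Finset.sum_le_sum fun j _ => h i j
  obtain ⟨j, -, hj⟩ := Finset.exists_le_of_sum_le (s := Finset.univ)
    (f := fun j : ι → Fin N => ∑ i, g i j * N) (g := fun _ => ∑ _i : ι, C)
    Finset.univ_nonempty (by
      rw [Finset.sum_comm]
      conv_rhs => rw [Finset.sum_comm]
      exact Finset.sum_le_sum fun i _ => hline i)
  refine ⟨j, ?_⟩
  rw [le_div_iff₀ hN', Finset.sum_mul]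
  simpa using hj

/-- A nonexpanding map on a large ball that is isometric up to an additive error `C` is, near some
point of the ball, isometric on given pairs of points up to a small fraction of `C`. -/
theorem Seminorm.exists_sub_dist_le {X E ι : Type*} [MetricSpace X] [AddCommGroup E] [Module ℝ E]
    [Fintype ι] (p : Seminorm ℝ E) (Φ : E → X) (R C : ℝ)
    (hlip : ∀ x y, p x ≤ R → p y ≤ R → dist (Φ x) (Φ y) ≤ p (x - y))
    (hΦ : ∀ x y, p x ≤ R → p y ≤ R → p (x - y) - C ≤ dist (Φ x) (Φ y))
    (a w : ι → E) {N : ℕ} (hN : 0 < N)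
    (hR : ∀ i, N * ∑ i, p (w i) + p (a i) ≤ R) :
    ∃ z, ∀ i, |dist (Φ (z + a i)) (Φ (z + (a i + w i))) - p (w i)| ≤
      Fintype.card ι * C / N := by
  classical
  have hbound : ∀ (c : ι → ℝ), (∀ i, 0 ≤ c i ∧ c i ≤ N) → ∀ i,
      p (∑ q, c q • w q + a i) ≤ R := by
    intro c hc i
    refine le_trans ((map_add_le_add p _ _).trans ?_) (hR i)
    gcongr
    rw [Finset.mul_sum]
    refine (Finset.le_sum_of_subadditive p (map_zero p).le (map_add_le_add p) _ _).trans ?_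
    refine Finset.sum_le_sum fun q _ => ?_
    rw [map_smul_eq_mul, Real.norm_of_nonneg (hc q).1]
    exact mul_le_mul_of_nonneg_right (hc q).2 (apply_nonneg p _)
  have hupd : ∀ (c : ι → ℝ) i (t : ℝ), ∑ q, Function.update c i t q • w q =
      ∑ q, Function.update c i 0 q • w q + t • w i := by
    intro c i t
    rw [← Finset.add_sum_erase _ _ (Finset.mem_univ i),
      ← Finset.add_sum_erase (a := i) _ (fun q => Function.update c i 0 q • w q)
        (Finset.mem_univ i)]
    have : ∀ s : ℝ, ∑ q ∈ Finset.univ.erase i, Function.update c i s q • w q =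
        ∑ q ∈ Finset.univ.erase i, c q • w q := fun s =>
      Finset.sum_congr rfl fun q hq => by
        rw [Function.update_of_ne (Finset.ne_of_mem_erase hq)]
    simp only [this, Function.update_self, zero_smul, zero_add]
    rw [add_comm]
  have hmem : ∀ (c : ι → ℝ) i (t : ℝ), (∀ i, 0 ≤ c i ∧ c i ≤ N) → 0 ≤ t → t ≤ N →
      p (∑ q, Function.update c i 0 q • w q + a i + t • w i) ≤ R := by
    intro c i t hc h0 h1
    rw [add_right_comm, ← hupd]
    refine hbound _ (fun q => ?_) i
    rcases eq_or_ne q i with rfl | hq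
    · simp [h0, h1]
    · simpa [hq] using hc q
  have hcast : ∀ (j : ι → Fin N) i, (0 : ℝ) ≤ (j i : ℕ) ∧ ((j i : ℕ) : ℝ) + 1 ≤ N := fun j i =>
    ⟨Nat.cast_nonneg _, by exact_mod_cast (j i).2⟩
  have hcast' : ∀ (j : ι → Fin N) i, (0 : ℝ) ≤ (j i : ℕ) ∧ ((j i : ℕ) : ℝ) ≤ N := fun j i =>
    ⟨(hcast j i).1, by linarith [(hcast j i).2]⟩
  set z : (ι → Fin N) → E := fun j => ∑ q, ((j q : ℕ) : ℝ) • w q with hz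
  have hzupd : ∀ j i (t : Fin N), z (Function.update j i t) =
      ∑ q, Function.update (fun q => ((j q : ℕ) : ℝ)) i 0 q • w q + ((t : ℕ) : ℝ) • w i := by
    intro j i t
    rw [← hupd, hz]
    refine Finset.sum_congr rfl fun q _ => ?_
    rcases eq_or_ne q i with rfl | hq
    · simp
    · simp [hq]
  set g : ι → (ι → Fin N) → ℝ := fun i j =>
    p (w i) - dist (Φ (z j + a i)) (Φ (z j + (a i + w i))) with hg
  have hg0 : ∀ i j, 0 ≤ g i j := by
    intro i j
    have e := hzupd j i (j i)
    rw [Function.update_eq_self] at e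
    have h1 := hmem _ i (j i : ℕ) (hcast' j) (hcast j i).1 (hcast' j i).2
    have h2 := hmem _ i ((j i : ℕ) + 1) (hcast' j) (by positivity) (hcast j i).2
    rw [add_right_comm, ← e] at h1
    rw [add_smul, one_smul, ← add_assoc, add_right_comm _ (a i), ← e, add_assoc] at h2
    have h3 := hlip _ _ h1 h2
    rw [show z j + a i - (z j + (a i + w i)) = -w i by abel, map_neg_eq_map] at h3
    exact sub_nonneg.2 h3
  obtain ⟨j, hj⟩ := exists_sum_le_of_sum_update_le hN g C (by
    intro i j
    set b : E := ∑ q, Function.update (fun q => ((j q : ℕ) : ℝ)) i 0 q • w q + a i with hb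
    have hterm : ∀ t : Fin N, g i (Function.update j i t) =
        p (w i) - dist (Φ (b + ((t : ℕ) : ℝ) • w i)) (Φ (b + (((t : ℕ) + 1 : ℕ) : ℝ) • w i)) := by
      intro t
      simp only [hg, hzupd, hb]
      congr 3
      · abel_nf
      · push_cast
        rw [add_smul, one_smul]
        abel_nf
    simp only [hterm]
    rw [Fin.sum_univ_eq_sum_range (fun t : ℕ =>
      p (w i) - dist (Φ (b + (t : ℝ) • w i)) (Φ (b + ((t + 1 : ℕ) : ℝ) • w i))),
      Finset.sum_sub_distrib]
    have h1 := dist_le_range_sum_dist (fun t : ℕ => Φ (b + (t : ℝ) • w i)) N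
    have h2 := hΦ (b + ((0 : ℕ) : ℝ) • w i) (b + (N : ℝ) • w i)
      (hmem _ i _ (hcast' j) (by simp) (by simp)) (hmem _ i _ (hcast' j) (by simp) le_rfl)
    have h3 : p (b + ((0 : ℕ) : ℝ) • w i - (b + (N : ℝ) • w i)) = N * p (w i) := by
      rw [show b + ((0 : ℕ) : ℝ) • w i - (b + (N : ℝ) • w i) = -((N : ℝ) • w i) by
        simp, map_neg_eq_map, map_smul_eq_mul]
      simp
    rw [h3] at h2
    simp only [Finset.sum_const, Finset.card_range, nsmul_eq_mul]
    linarith)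
  refine ⟨z j, fun i => ?_⟩
  rw [abs_sub_comm, abs_of_nonneg (hg0 i j)]
  exact (Finset.single_le_sum (fun i _ => hg0 i j) (Finset.mem_univ i)).trans hj

/-- **Lemma 3.3 (Step 3).** From a relative Hausdorff approximation of `1`-Lipschitz maps
into a proper metric space with cocompact isometry group, one may construct an isometric
embedding of the normed space `(ℝ^n, ν)`. -/
theorem stmt13 {X : Type*} [MetricSpace X] [ProperSpace X]
    (hcc : CocompactIsometryGroup X)
    {n : ℕ} (ν : (Fin n → ℝ) → ℝ) (hν : IsNorm ν)
    (R : ℕ → ℝ) (ε : ℕ → ℝ) (hRpos : ∀ k, 0 < R k) (hεpos : ∀ k, 0 < ε k)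
    (hRinf : Filter.Tendsto R Filter.atTop Filter.atTop)
    (hε0 : Filter.Tendsto ε Filter.atTop (nhds 0))
    (Φ : ℕ → (Fin n → ℝ) → X)
    (hΦlip : ∀ k, ∀ x y : Fin n → ℝ, ν x ≤ R k → ν y ≤ R k →
      dist (Φ k x) (Φ k y) ≤ 1 * ν (x - y))
    (hΦ : ∀ k, ∀ x y : Fin n → ℝ, ν x ≤ R k → ν y ≤ R k →
      |dist (Φ k x) (Φ k y) - ν (x - y)| ≤ R k * ε k) :
    ∃ f : (Fin n → ℝ) → X, ∀ x y, dist (f x) (f y) = ν (x - y) := by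
  obtain ⟨-, hadd, hsmul⟩ := hν
  obtain ⟨p, rfl⟩ : ∃ p : Seminorm ℝ (Fin n → ℝ), ⇑p = ν := ⟨Seminorm.of ν hadd hsmul, rfl⟩
  have : Nonempty X := ⟨Φ 0 0⟩
  refine hcc.exists_dist_eq (fun x y => p (x - y)) fun F δ hδ => ?_
  set a : F × F → (Fin n → ℝ) := fun i => i.1
  set w : F × F → (Fin n → ℝ) := fun i => i.2 - i.1
  set W : ℝ := ∑ i, p (w i)
  set M : ℝ := ∑ i, p (a i)
  set P : ℝ := (Fintype.card (F × F) : ℝ)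
  have hW : 0 ≤ W := Finset.sum_nonneg fun i _ => apply_nonneg p _
  have hP : 0 ≤ P := Nat.cast_nonneg _
  have hsmall : Filter.Tendsto (fun k => P * (4 * (W + 1)) * ε k) Filter.atTop (nhds 0) := by
    simpa using hε0.const_mul (P * (4 * (W + 1)))
  obtain ⟨k, hkδ, hkM, hkW⟩ := ((hsmall.eventually_le_const hδ).and
    ((hRinf.eventually_ge_atTop (2 * M)).and
      (hRinf.eventually_ge_atTop (2 * (W + 1))))).exists
  set N : ℕ := ⌊R k / (2 * (W + 1))⌋₊
  have hone : 1 ≤ R k / (2 * (W + 1)) := by rwa [le_div_iff₀ (by positivity), one_mul]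
  have hN : 0 < N := Nat.floor_pos.2 hone
  have hN1 : (1 : ℝ) ≤ N := by exact_mod_cast hN
  have hNle : N * (2 * (W + 1)) ≤ R k := by
    rw [← le_div_iff₀ (by positivity)]
    exact Nat.floor_le (by linarith)
  have hRN : R k ≤ 4 * (W + 1) * N := by
    have h1 : R k < (N + 1) * (2 * (W + 1)) := by
      rw [← div_lt_iff₀ (by positivity)]
      exact Nat.lt_floor_add_one _
    nlinarith
  obtain ⟨z, hz⟩ := p.exists_sub_dist_le (Φ k) (R k) (R k * ε k)
    (fun x y hx hy => by simpa using hΦlip k x y hx hy)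
    (fun x y hx hy => by linarith [(abs_le.1 (hΦ k x y hx hy)).1]) a w hN (fun i => by
      have hi : p (a i) ≤ M :=
        Finset.single_le_sum (f := fun i => p (a i)) (fun i _ => apply_nonneg p _)
          (Finset.mem_univ i)
      change N * W + p (a i) ≤ R k
      linarith)
  refine ⟨fun x => Φ k (z + x), fun x hx y hy => ?_⟩
  have hxy := hz (⟨x, hx⟩, ⟨y, hy⟩)
  simp only [a, w, add_sub_cancel] at hxy
  rw [map_sub_rev p x y]
  refine hxy.trans (le_trans ?_ hkδ)
  rw [div_le_iff₀ (by linarith)]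
  calc P * (R k * ε k) ≤ P * (4 * (W + 1) * N * ε k) := by
        have := (hεpos k).le
        gcongr
    _ = P * (4 * (W + 1)) * ε k * N := by ring
end

section
/- For every m ∈ ℕ there is a constant l = l(m) ≥ 0 such that: for every metric space X admitting a conical geodesic bicombing, every c ≥ 0, and every c-Lipschitz map f from the unit sphere S^m ⊂ ℝ^{m+1} (with the Euclidean metric) to X, there exists an (l·c)-Lipschitz map from the closed unit ball B^{m+1} ⊂ ℝ^{m+1} to X extending f. In other words, every metric space with a conical geodesic bicombing is Lipschitz n-connected for every n. -/
/-- Polar decomposition: every vector of a nontrivial real normed space is its norm times a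
unit vector. -/
theorem exists_unit_norm_smul_eq {E : Type*} [NormedAddCommGroup E] [NormedSpace ℝ E]
    [Nontrivial E] (x : E) : ∃ u : Metric.sphere (0 : E) 1, ‖x‖ • (u : E) = x := by
  by_cases hx : x = 0
  · obtain ⟨v, hv⟩ := exists_norm_eq E zero_le_one
    exact ⟨⟨v, by simpa using hv⟩, by simp [hx]⟩
  · exact ⟨⟨‖x‖⁻¹ • x, by simp [norm_smul, hx]⟩, by simp [smul_smul, hx]⟩

/-- Coning off to a point of the image extends a `c`-Lipschitz map on the unit sphere of a
normed space to a `4 * c`-Lipschitz map on the unit ball. -/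
theorem IsConicalBicombing.exists_extension_closedBall {X : Type*} [MetricSpace X]
    {σ : X → X → ℝ → X} (hσ : IsConicalBicombing σ)
    {E : Type*} [NormedAddCommGroup E] [NormedSpace ℝ E] [Nontrivial E]
    {c : ℝ} (hc : 0 ≤ c) (f : Metric.sphere (0 : E) 1 → X)
    (hf : ∀ p q, dist (f p) (f q) ≤ c * dist p q) :
    ∃ g : Metric.closedBall (0 : E) 1 → X,
      (∀ p : Metric.sphere (0 : E) 1,
        g ⟨(p : E), Metric.sphere_subset_closedBall p.2⟩ = f p) ∧
      (∀ p q, dist (g p) (g q) ≤ (4 * c) * dist p q) := by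
  obtain ⟨-, h1, hgeo, hcon⟩ := hσ
  choose u hu using exists_unit_norm_smul_eq (E := E)
  let z : X := f (u 0)
  refine ⟨fun p => σ z (f (u p)) ‖(p : E)‖, fun p => ?_, fun p q => ?_⟩
  · have hp : ‖(p : E)‖ = 1 := by simp
    have hup : u (p : E) = p := Subtype.ext (by simpa [hp] using hu (p : E))
    simp only [hp, h1, hup]
  · have hmem (x : Metric.closedBall (0 : E) 1) : ‖(x : E)‖ ∈ Set.Icc (0 : ℝ) 1 :=
      ⟨norm_nonneg _, mem_closedBall_zero_iff.mp x.2⟩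
    have hdiff : |‖(p : E)‖ - ‖(q : E)‖| ≤ dist p q := by
      rw [Subtype.dist_eq, dist_eq_norm]
      exact abs_norm_sub_norm_le _ _
    have hdiam : dist z (f (u p)) ≤ 2 * c := by
      have h2 : dist (u 0) (u p) ≤ 2 := by
        rw [Subtype.dist_eq, dist_eq_norm]
        refine (norm_sub_le _ _).trans ?_
        simp only [norm_eq_of_mem_sphere]
        norm_num
      calc dist z (f (u p)) ≤ c * dist (u 0) (u p) := hf _ _
        _ ≤ 2 * c := by nlinarith
    have hradial : dist (σ z (f (u p)) ‖(p : E)‖) (σ z (f (u p)) ‖(q : E)‖)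
        ≤ dist p q * (2 * c) := by
      rw [hgeo _ _ _ (hmem p) _ (hmem q)]
      gcongr
    have hangle : ‖(q : E)‖ * dist (u p) (u q) ≤ 2 * dist p q := by
      have hsplit : ‖(q : E)‖ • ((u p : E) - (u q : E))
          = (‖(q : E)‖ - ‖(p : E)‖) • (u p : E) + ((p : E) - (q : E)) := by
        rw [smul_sub, sub_smul, hu, hu]
        abel
      have hnorm := norm_add_le ((‖(q : E)‖ - ‖(p : E)‖) • (u p : E)) ((p : E) - (q : E))
      rw [← hsplit, norm_smul, norm_smul, norm_eq_of_mem_sphere, norm_norm, Real.norm_eq_abs,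
        abs_sub_comm, mul_one, ← dist_eq_norm, ← dist_eq_norm, ← Subtype.dist_eq,
        ← Subtype.dist_eq] at hnorm
      linarith
    have hspherical : dist (σ z (f (u p)) ‖(q : E)‖) (σ z (f (u q)) ‖(q : E)‖)
        ≤ c * (2 * dist p q) := by
      calc _ ≤ (1 - ‖(q : E)‖) * dist z z + ‖(q : E)‖ * dist (f (u p)) (f (u q)) :=
            hcon _ _ _ _ _ (hmem q)
        _ ≤ ‖(q : E)‖ * (c * dist (u p) (u q)) := by
            rw [dist_self, mul_zero, zero_add]
            gcongr
            exact hf _ _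
        _ = c * (‖(q : E)‖ * dist (u p) (u q)) := by ring
        _ ≤ c * (2 * dist p q) := by gcongr
    have htri := dist_triangle (σ z (f (u p)) ‖(p : E)‖) (σ z (f (u p)) ‖(q : E)‖)
      (σ z (f (u q)) ‖(q : E)‖)
    show dist (σ z (f (u p)) ‖(p : E)‖) (σ z (f (u q)) ‖(q : E)‖) ≤ 4 * c * dist p q
    linarith

/-- Every metric space with a conical geodesic bicombing is Lipschitz `n`-connected for
every `n`: for each `m` there is a constant `l = l(m)` such that every `c`-Lipschitz map
from the unit sphere `S^m ⊆ ℝ^{m+1}` extends to an `l·c`-Lipschitz map on the closed unit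
ball `B^{m+1}`. -/
theorem stmt15 (m : ℕ) :
    ∃ l : ℝ, 0 ≤ l ∧
      ∀ (X : Type*) [MetricSpace X],
        ∀ σ : X → X → ℝ → X, IsConicalBicombing σ →
        ∀ c : ℝ, 0 ≤ c →
        ∀ f : (Metric.sphere (0 : EuclideanSpace ℝ (Fin (m + 1))) 1) → X,
          (∀ p q, dist (f p) (f q) ≤ c * dist p q) →
          ∃ g : (Metric.closedBall (0 : EuclideanSpace ℝ (Fin (m + 1))) 1) → X,
            (∀ p : Metric.sphere (0 : EuclideanSpace ℝ (Fin (m + 1))) 1,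
              g ⟨(p : EuclideanSpace ℝ (Fin (m + 1))),
                  Metric.sphere_subset_closedBall p.2⟩ = f p) ∧
            (∀ p q, dist (g p) (g q) ≤ (l * c) * dist p q) := by
  exact ⟨4, by norm_num, fun _ _ _ hσ _ hc f hf => hσ.exists_extension_closedBall hc f hf⟩
end

section
/- Let X be a metric space admitting a conical geodesic bicombing σ, and let X̄ be the metric completion of X with embedding ι : X → X̄. Then X̄ admits a conical geodesic bicombing σ̄ extending σ, i.e., with σ̄(ι(x),ι(y),t) = ι(σ(x,y,t)) for all x,y ∈ X and t ∈ [0,1]; moreover σ̄(x,y,t) = lim_{k→∞} σ(x_k,y_k,t) for any sequences x_k → x, y_k → y with x_k, y_k ∈ X, the limit being independent of the chosen sequences. -/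
theorem IsConicalBicombing.uniformContinuous₂ {X : Type*} [MetricSpace X] {σ : X → X → ℝ → X}
    (hσ : IsConicalBicombing σ) {t : ℝ} (ht : t ∈ Set.Icc (0 : ℝ) 1) :
    UniformContinuous₂ fun x y => σ x y t := by
  refine (LipschitzWith.of_dist_le_mul (K := 1) fun p q => ?_).uniformContinuous
  have h := hσ.2.2.2 p.1 p.2 q.1 q.2 t ht
  have h₁ : dist p.1 q.1 ≤ dist p q := le_max_left _ _
  have h₂ : dist p.2 q.2 ≤ dist p q := le_max_right _ _
  have h₃ := mul_le_mul_of_nonneg_left h₁ (sub_nonneg.2 ht.2)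
  have h₄ := mul_le_mul_of_nonneg_left h₂ ht.1
  simp only [Function.uncurry, NNReal.coe_one]
  linarith

/-- A conical geodesic bicombing on `X` extends to a conical geodesic bicombing on the
metric completion of `X`, given on limits of sequences from `X` by
`σ̄(x, y, t) = lim σ(x_k, y_k, t)` (independently of the approximating sequences). -/
theorem stmt17 {X : Type*} [MetricSpace X]
    (σ : X → X → ℝ → X) (hσ : IsConicalBicombing σ) :
    ∃ σ' : UniformSpace.Completion X → UniformSpace.Completion X → ℝ →
        UniformSpace.Completion X,
      IsConicalBicombing σ' ∧
      (∀ x y : X, ∀ t ∈ Set.Icc (0:ℝ) 1,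
        σ' (x : UniformSpace.Completion X) (y : UniformSpace.Completion X) t
          = ((σ x y t : X) : UniformSpace.Completion X)) ∧
      (∀ a b : UniformSpace.Completion X, ∀ t ∈ Set.Icc (0:ℝ) 1,
        ∀ u v : ℕ → X,
          Filter.Tendsto (fun k => ((u k : X) : UniformSpace.Completion X))
            Filter.atTop (nhds a) →
          Filter.Tendsto (fun k => ((v k : X) : UniformSpace.Completion X))
            Filter.atTop (nhds b) →
          Filter.Tendsto (fun k => ((σ (u k) (v k) t : X) : UniformSpace.Completion X))
            Filter.atTop (nhds (σ' a b t))) := by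
  let τ : UniformSpace.Completion X → UniformSpace.Completion X → ℝ →
      UniformSpace.Completion X :=
    fun a b t => UniformSpace.Completion.map₂ (fun x y => σ x y t) a b
  have hτ : ∀ x y : X, ∀ t ∈ Set.Icc (0 : ℝ) 1, τ x y t = (σ x y t : X) := fun x y t ht =>
    UniformSpace.Completion.map₂_coe_coe x y _ (hσ.uniformContinuous₂ ht)
  have hc : ∀ t, Continuous fun p : UniformSpace.Completion X × UniformSpace.Completion X =>
      τ p.1 p.2 t := fun t =>
    UniformSpace.Completion.continuous_map₂ continuous_fst continuous_snd
  refine ⟨τ, ⟨fun a b => ?_, fun a b => ?_, fun a b t ht t' ht' => ?_,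
    fun a b a' b' t ht => ?_⟩, hτ, fun a b t ht u v hu hv => ?_⟩
  · induction a, b using UniformSpace.Completion.induction_on₂ with
    | hp => exact isClosed_eq (hc 0) continuous_fst
    | ih x y => rw [hτ x y 0 (by simp), hσ.1]
  · induction a, b using UniformSpace.Completion.induction_on₂ with
    | hp => exact isClosed_eq (hc 1) continuous_snd
    | ih x y => rw [hτ x y 1 (by simp), hσ.2.1]
  · induction a, b using UniformSpace.Completion.induction_on₂ with
    | hp => exact isClosed_eq ((hc t).dist (hc t')) (continuous_const.mul continuous_dist)
    | ih x y =>
      simpa only [hτ x y t ht, hτ x y t' ht', UniformSpace.Completion.dist_eq] using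
        hσ.2.2.1 x y t ht t' ht'
  · have key : ∀ p q : UniformSpace.Completion X × UniformSpace.Completion X,
        dist (τ p.1 p.2 t) (τ q.1 q.2 t) ≤ (1 - t) * dist p.1 q.1 + t * dist p.2 q.2 := by
      have hd : DenseRange fun p : (X × X) × (X × X) =>
          ((((p.1.1 : X) : UniformSpace.Completion X), ((p.1.2 : X) : UniformSpace.Completion X)),
            (((p.2.1 : X) : UniformSpace.Completion X),
              ((p.2.2 : X) : UniformSpace.Completion X))) :=
        have h := UniformSpace.Completion.denseRange_coe (α := X)
        (h.prodMap h).prodMap (h.prodMap h)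
      intro p q
      refine hd.induction_on (p := fun r => dist (τ r.1.1 r.1.2 t) (τ r.2.1 r.2.2 t) ≤
        (1 - t) * dist r.1.1 r.2.1 + t * dist r.1.2 r.2.2) (p, q) ?_ ?_
      · exact isClosed_le (((hc t).comp continuous_fst).dist ((hc t).comp continuous_snd))
          (by fun_prop)
      · rintro ⟨⟨x, y⟩, x', y'⟩
        simpa only [hτ _ _ t ht, UniformSpace.Completion.dist_eq] using hσ.2.2.2 x y x' y' t ht
    exact key (a, b) (a', b')
  · simpa only [Function.comp_def, hτ _ _ t ht] using
      ((hc t).tendsto (a, b)).comp (hu.prodMk_nhds hv)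
end
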